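/- Fix an integer p ≥ 2 and c ∈ (0,1/2), and let γ_n, β_n, α_n, θ_n, a_n, c_n, k_n(t) be as in the standing setup. Define ν̄_n^t(u,∞) = k_n(t)·𝒫(max_{1≤j≤θ_n} e^{β_n H_n(J_n(j))} e_{n,j} > c_n u^{β_n/γ_n} | H_n). Then for every u > 0 and t > 0, lim_{n→∞} 𝔼[ν̄_n^t(u,∞)] = 2p·t·u^{-1}, and the same limit holds when u is replaced by the sequence u_n = u·θ_n^{−α_n}. -/

import Mathlib

open MeasureTheory ProbabilityTheory Filter Real Finset

/-- Configuration space: the hypercube `Σ_n = {−1,1}^n`, encoded as `Fin n → Bool`,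
with the Hamming distance as graph distance. -/
abbrev V (n : ℕ) := Fin n → Bool

/-- Overlap `R_n(x,x') = 1 − 2·dist(x,x')/n`. -/
noncomputable def overlap (n : ℕ) (x y : V n) : ℝ := 1 - 2 * (hammingDist x y : ℝ) / n

/-- `γ_n = n^{-c}`. -/
noncomputable def γseq (c : ℝ) (n : ℕ) : ℝ := (n : ℝ) ^ (-c)

/-- Block length `θ_n = 3n²`. -/
def θseq (n : ℕ) : ℕ := 3 * n ^ 2

/-- Jump scale `a_n = √(2πn)·γ_n⁻¹·e^{γ_n²n/2}`. -/
noncomputable def aseq (c : ℝ) (n : ℕ) : ℝ :=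
  Real.sqrt (2 * π * n) * (γseq c n)⁻¹ * Real.exp ((γseq c n) ^ 2 * n / 2)

/-- Time scale `c_n = e^{γ_nβ_n n}`. -/
noncomputable def cseq (c : ℝ) (β : ℕ → ℝ) (n : ℕ) : ℝ := Real.exp (γseq c n * β n * n)

/-- `k_n(t) = ⌊⌊a_n t⌋/θ_n⌋`. -/
noncomputable def kseq (c : ℝ) (n : ℕ) (t : ℝ) : ℕ := ⌊aseq c n * t⌋₊ / θseq n

/-- `X` is a centered Gaussian random vector with covariance `Δ`: every linear combination
of its coordinates is a centered real Gaussian with the corresponding variance. -/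
def IsCenteredGaussianVector {Ω : Type*} [MeasurableSpace Ω] (P : Measure Ω)
    {I : Type*} [Fintype I] (X : I → Ω → ℝ) (Δ : I → I → ℝ) : Prop :=
  ∀ c : I → ℝ, Measure.map (fun ω => ∑ i, c i * X i ω) P =
    gaussianReal 0 (Real.toNNReal (∑ i, ∑ j, c i * c j * Δ i j))

/-- Joint law of the dynamics: `J n` is the simple random walk on `Σ_n` started from the
uniform distribution, `(e n j)` are i.i.d. mean-one exponentials, and the walk and the
exponentials are independent; all of this is encoded through the joint finite-dimensional
distributions. -/
def WalkExpLaw {Ω' : Type*} [MeasurableSpace Ω'] (Pw : Measure Ω')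
    (J : (n : ℕ) → ℕ → Ω' → V n) (e : ℕ → ℕ → Ω' → ℝ) : Prop :=
  ∀ (n m : ℕ) (xs : Fin (m + 1) → V n) (ys : Fin (m + 1) → ℝ), (∀ k, 0 ≤ ys k) →
    Pw {ω' | (∀ k : Fin (m + 1), J n k ω' = xs k) ∧ (∀ k : Fin (m + 1), ys k < e n k ω')} =
      ENNReal.ofReal (((2 : ℝ) ^ n)⁻¹ *
        ∏ k : Fin m, (if hammingDist (xs k.castSucc) (xs k.succ) = 1 then (n : ℝ)⁻¹ else 0)) *
      ENNReal.ofReal (Real.exp (-∑ k, ys k))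

/-- `ν̄_n^t(u,∞) = k_n(t)·𝒫(max_{1≤j≤θ_n} e^{β_n h(J_n(j))} e_{n,j} > c_n u^{β_n/γ_n})`,
for a fixed realization `h` of the environment. -/
noncomputable def nuMax {Ω' : Type*} [MeasurableSpace Ω'] (Pw : Measure Ω')
    (J : (n : ℕ) → ℕ → Ω' → V n) (e : ℕ → ℕ → Ω' → ℝ)
    (c : ℝ) (β : ℕ → ℝ) (n : ℕ) (t u : ℝ) (h : V n → ℝ) : ℝ :=
  (kseq c n t : ℝ) *
    (Pw {ω' | ∃ j ∈ Icc 1 (θseq n), cseq c β n * u ^ (β n / γseq c n) <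
      Real.exp (β n * h (J n j ω')) * e n j ω'}).toReal

set_option linter.unusedSimpArgs false
set_option linter.unusedVariables false
set_option linter.unusedSectionVars false

/-- Centered Gaussian law on a finite product with constant variance `v`. -/
structure GV {I : Type} [Fintype I] (μ : Measure (I → ℝ)) (Δ : I → I → ℝ) (v : ℝ) : Prop where
  prob : IsProbabilityMeasure μ
  gauss : IsCenteredGaussianVector μ (fun i h => h i) Δ
  symm : ∀ i j, Δ i j = Δ j i
  diag : ∀ i, Δ i i = v
  vpos : 0 < v
  bd : ∀ i j, |Δ i j| ≤ v

namespace GV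
variable {I : Type} [Fintype I] {μ : Measure (I → ℝ)} {Δ : I → I → ℝ} {v : ℝ}

lemma pair (hG : GV μ Δ v) (i j : I) (a b : ℝ) :
    μ.map (fun h => a * h i + b * h j) =
      gaussianReal 0 (Real.toNNReal (a ^ 2 * v + 2 * a * b * Δ i j + b ^ 2 * v)) := by
  classical
  have := hG.gauss (fun k => (if k = i then a else 0) + (if k = j then b else 0))
  simp only [add_mul, mul_add, Finset.sum_add_distrib, ite_mul, zero_mul, mul_ite, mul_zero,
    Finset.sum_ite_eq', Finset.mem_univ, if_true, Finset.sum_ite_eq, Finset.sum_ite_irrel,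
    Finset.sum_const_zero] at this
  rw [this]
  congr 2
  rw [hG.diag, hG.diag, hG.symm j i]; ring

lemma isGaussian (hG : GV μ Δ v) : IsGaussian μ := by
  classical
  refine isGaussian_of_map_eq_gaussianReal fun L => ?_
  have : (L : (I → ℝ) → ℝ) = fun h => ∑ i, L (Pi.single i 1) * h i := by
    funext h
    conv_lhs => rw [pi_eq_sum_univ' h]
    simp only [map_sum]
    refine Finset.sum_congr rfl fun i _ => ?_
    rw [map_smul, smul_eq_mul, mul_comm]
  rw [this]
  exact ⟨_, _, hG.gauss _⟩

lemma memLp (hG : GV μ Δ v) (i : I) : MemLp (fun h : I → ℝ => h i) 2 μ := by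
  have := hG.isGaussian
  have h := (IsGaussian.hasGaussianLaw_id (μ := μ)).eval i
  exact h.memLp_two

lemma mean (hG : GV μ Δ v) (i : I) : ∫ h : I → ℝ, h i ∂μ = 0 := by
  have h := hG.pair i i 1 0
  have h2 : ∫ x, x ∂(μ.map (fun h : I → ℝ => 1 * h i + 0 * h i)) = 0 := by
    rw [h, integral_id_gaussianReal]
  rw [integral_map (by fun_prop) (by fun_prop)] at h2
  simpa using h2

lemma var_pair (hG : GV μ Δ v) (i j : I) (a b : ℝ) :
    Var[fun h : I → ℝ => a * h i + b * h j; μ] =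
      a ^ 2 * v + 2 * a * b * Δ i j + b ^ 2 * v := by
  have h := hG.pair i j a b
  have h2 : Var[fun x => x; μ.map (fun h : I → ℝ => a * h i + b * h j)] =
    (Real.toNNReal (a ^ 2 * v + 2 * a * b * Δ i j + b ^ 2 * v)) := by
    rw [h, variance_fun_id_gaussianReal]
  rw [variance_map (by fun_prop) (by fun_prop)] at h2
  rw [Real.coe_toNNReal] at h2
  · exact h2
  · have h1 := abs_le.1 (hG.bd i j)
    have hv := hG.vpos
    rcases le_total 0 (a * b) with h | h
    · nlinarith [sq_nonneg (a - b)]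
    · nlinarith [sq_nonneg (a + b)]

lemma cov (hG : GV μ Δ v) (i j : I) :
    cov[fun h : I → ℝ => h i, fun h : I → ℝ => h j; μ] = Δ i j := by
  have := hG.prob
  have h1 := hG.var_pair i j 1 1
  have h2 := hG.var_pair i j 1 0
  have h3 := hG.var_pair i j 0 1
  simp only [one_mul, zero_mul, add_zero, zero_add] at h1 h2 h3
  rw [variance_fun_add (hG.memLp i) (hG.memLp j), h2, h3] at h1
  linarith

lemma indep (hG : GV μ Δ v) (j : I) :
    IndepFun (fun h : I → ℝ => h j) (fun (h : I → ℝ) (i : I) => h i - Δ i j / v * h j) μ := by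
  have := hG.isGaussian
  have := hG.prob
  have key : IndepFun (fun (h : I → ℝ) (_ : Unit) => h j)
      (fun (h : I → ℝ) (i : I) => h i - Δ i j / v * h j) μ := by
    refine HasGaussianLaw.indepFun_of_covariance_eval
      (X := fun (_ : Unit) (h : I → ℝ) => h j)
      (Y := fun (i : I) (h : I → ℝ) => h i - Δ i j / v * h j) ?_ ?_
    · let L : (I → ℝ) →L[ℝ] (Unit → ℝ) × (I → ℝ) :=
        (ContinuousLinearMap.pi fun _ => ContinuousLinearMap.proj j).prod
          (ContinuousLinearMap.pi fun i => ContinuousLinearMap.proj i -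
            (Δ i j / v) • ContinuousLinearMap.proj j)
      exact (IsGaussian.hasGaussianLaw_id (μ := μ)).map L
    · intro _ i
      rw [covariance_fun_sub_right (hG.memLp j) (hG.memLp i) ((hG.memLp j).const_mul _),
        covariance_const_mul_right, hG.cov, hG.cov, hG.diag, hG.symm j i]
      field_simp [hG.vpos.ne']
      simp
  have m1 : Measurable (fun f : Unit → ℝ => f ()) := measurable_pi_apply ()
  exact key.comp (φ := fun f : Unit → ℝ => f ()) (ψ := id) m1 measurable_id

lemma law (hG : GV μ Δ v) (j : I) : μ.map (fun h : I → ℝ => h j) = gaussianReal 0 v.toNNReal := by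
  have h := hG.pair j j 1 0
  simpa using h

lemma lint_cond (hG : GV μ Δ v) (j : I) (f : ℝ → (I → ℝ) → ENNReal)
    (hf : Measurable (Function.uncurry f)) :
    ∫⁻ h, f (h j) h ∂μ =
      ∫⁻ z, ∫⁻ h, f z (fun i => h i + (z - h j) * (Δ i j / v)) ∂μ ∂(gaussianReal 0 v.toNNReal) := by
  have := hG.prob
  have hi := hG.indep j
  rw [indepFun_iff_map_prod_eq_prod_map_map (measurable_pi_apply j).aemeasurable
    (Measurable.aemeasurable (by fun_prop)), hG.law j] at hi
  let g : ℝ × (I → ℝ) → ENNReal := fun q => f q.1 (fun i => q.2 i + q.1 * (Δ i j / v))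
  have hg : Measurable g := by
    have : g = Function.uncurry f ∘ (fun q : ℝ × (I → ℝ) =>
      (q.1, fun i => q.2 i + q.1 * (Δ i j / v))) := rfl
    rw [this]
    exact hf.comp (by fun_prop)
  have e1 : ∫⁻ h, f (h j) h ∂μ = ∫⁻ h, g (h j, fun i => h i - Δ i j / v * h j) ∂μ := by
    refine lintegral_congr fun h => ?_
    simp only [g]
    congr 1
    funext i
    ring
  rw [e1, ← lintegral_map (f := g) (μ := μ)
    (g := fun h : I → ℝ => (h j, fun i => h i - Δ i j / v * h j)) hg (by fun_prop), hi,
    lintegral_prod _ hg.aemeasurable]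
  refine lintegral_congr fun z => ?_
  rw [lintegral_map (by exact hg.comp (by fun_prop)) (by fun_prop)]
  refine lintegral_congr fun h => ?_
  simp only [g]
  congr 1
  funext i
  ring

end GV

lemma gauss_tilt (v : ℝ) (hv : 0 < v) (l : ℝ) (f : ℝ → ENNReal) (hf : Measurable f) :
    ∫⁻ z, ENNReal.ofReal (exp (l * z)) * f z ∂(gaussianReal 0 v.toNNReal) =
      ENNReal.ofReal (exp (l ^ 2 * v / 2)) * ∫⁻ z, f z ∂(gaussianReal (l * v) v.toNNReal) := by
  have hv' : v.toNNReal ≠ 0 := by simpa using hv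
  rw [gaussianReal_of_var_ne_zero _ hv', gaussianReal_of_var_ne_zero _ hv',
    lintegral_withDensity_eq_lintegral_mul _ (measurable_gaussianPDF _ _) (by fun_prop),
    lintegral_withDensity_eq_lintegral_mul _ (measurable_gaussianPDF _ _) hf,
    ← lintegral_const_mul _ ((measurable_gaussianPDF _ _).mul hf)]
  refine lintegral_congr fun z => ?_
  simp only [Pi.mul_apply, gaussianPDF]
  rw [← mul_assoc, ← mul_assoc, ← ENNReal.ofReal_mul (gaussianPDFReal_nonneg _ _ _),
    ← ENNReal.ofReal_mul (exp_nonneg _)]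
  congr 2
  simp only [gaussianPDFReal, Real.coe_toNNReal v hv.le]
  rw [mul_assoc, ← exp_add, mul_left_comm, ← exp_add]
  congr 2
  field_simp
  ring

namespace GV
variable {I : Type} [Fintype I] {μ : Measure (I → ℝ)} {Δ : I → I → ℝ} {v : ℝ}

lemma tilt_lint (hG : GV μ Δ v) (j : I) (l : ℝ) (F : (I → ℝ) → ENNReal) (hF : Measurable F) :
    ∫⁻ h, ENNReal.ofReal (exp (l * h j)) * F h ∂μ =
      ENNReal.ofReal (exp (l ^ 2 * v / 2)) * ∫⁻ h, F (fun i => h i + l * Δ i j) ∂μ := by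
  have := hG.prob
  have hv := hG.vpos
  rw [hG.lint_cond j (fun z h => ENNReal.ofReal (exp (l * z)) * F h) (by
    unfold Function.uncurry; fun_prop)]
  have hm : Measurable (fun z : ℝ => ∫⁻ h, F (fun i => h i + (z - h j) * (Δ i j / v)) ∂μ) := by
    refine Measurable.lintegral_prod_right' (f := fun q : ℝ × (I → ℝ) =>
      F (fun i => q.2 i + (q.1 - q.2 j) * (Δ i j / v))) ?_
    exact hF.comp (by fun_prop)
  have e1 : ∀ z : ℝ, ∫⁻ h, ENNReal.ofReal (exp (l * z)) *
      F (fun i => h i + (z - h j) * (Δ i j / v)) ∂μ = ENNReal.ofReal (exp (l * z)) *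
      ∫⁻ h, F (fun i => h i + (z - h j) * (Δ i j / v)) ∂μ := fun z => by
    rw [lintegral_const_mul]
    exact hF.comp (by fun_prop)
  simp_rw [e1]
  rw [gauss_tilt v hv l _ hm]
  congr 1
  rw [show gaussianReal (l * v) v.toNNReal = (gaussianReal 0 v.toNNReal).map (· + l * v) by
    rw [gaussianReal_map_add_const]; simp, lintegral_map hm (by fun_prop)]
  rw [hG.lint_cond j (fun z h => F (fun i => h i + l * Δ i j)) (by
    unfold Function.uncurry; fun_prop)]
  refine lintegral_congr fun z => lintegral_congr fun h => ?_
  congr 1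
  funext i
  field_simp
  ring

lemma tilt_meas (hG : GV μ Δ v) (j : I) (l : ℝ) :
    μ.withDensity (fun h => ENNReal.ofReal (exp (l * h j))) =
      ENNReal.ofReal (exp (l ^ 2 * v / 2)) • μ.map (fun h i => h i + l * Δ i j) := by
  ext s hs
  rw [withDensity_apply _ hs, ← lintegral_indicator hs, Measure.smul_apply, smul_eq_mul,
    Measure.map_apply (by fun_prop) hs]
  have := hG.tilt_lint j l (s.indicator 1) (measurable_one.indicator hs)
  have e2 : ∫⁻ h, s.indicator (1 : (I → ℝ) → ENNReal) (fun i => h i + l * Δ i j) ∂μ =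
    μ ((fun h i => h i + l * Δ i j) ⁻¹' s) := by
    rw [← lintegral_indicator_one ((by fun_prop : Measurable
      (fun (h : I → ℝ) i => h i + l * Δ i j)) hs)]
    rfl
  rw [e2] at this
  rw [← this]
  refine lintegral_congr fun h => ?_
  by_cases hh : h ∈ s <;> simp [hh]

lemma tilt_integrable (hG : GV μ Δ v) (j : I) (l : ℝ) (F : (I → ℝ) → ℝ) (hF : Measurable F)
    (hI : Integrable (fun h => F (fun i => h i + l * Δ i j)) μ) :
    Integrable (fun h => exp (l * h j) * F h) μ := by
  have h1 : Integrable F (μ.withDensity (fun h => ENNReal.ofReal (exp (l * h j)))) := by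
    rw [hG.tilt_meas]
    refine Integrable.smul_measure ?_ ENNReal.ofReal_ne_top
    rw [integrable_map_measure hF.aestronglyMeasurable (Measurable.aemeasurable (by fun_prop))]
    exact hI
  rw [integrable_withDensity_iff_integrable_smul' (by fun_prop) (by simp)] at h1
  refine h1.congr (ae_of_all _ fun h => ?_)
  simp [ENNReal.toReal_ofReal (exp_nonneg _)]

lemma tilt_int (hG : GV μ Δ v) (j : I) (l : ℝ) (F : (I → ℝ) → ℝ) (hF : Measurable F) :
    ∫ h, exp (l * h j) * F h ∂μ =
      exp (l ^ 2 * v / 2) * ∫ h, F (fun i => h i + l * Δ i j) ∂μ := by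
  have h1 : ∫ h, F h ∂(μ.withDensity (fun h => ENNReal.ofReal (exp (l * h j)))) =
      exp (l ^ 2 * v / 2) * ∫ h, F (fun i => h i + l * Δ i j) ∂μ := by
    rw [hG.tilt_meas, integral_smul_measure, integral_map (Measurable.aemeasurable (by fun_prop))
      hF.aestronglyMeasurable, ENNReal.toReal_ofReal (exp_nonneg _), smul_eq_mul]
  rw [integral_withDensity_eq_integral_toReal_smul (by fun_prop) (by simp)] at h1
  rw [← h1]
  refine integral_congr_ae (ae_of_all _ fun h => ?_)
  simp [ENNReal.toReal_ofReal (exp_nonneg _)]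

lemma exp_pair (hG : GV μ Δ v) (i j : I) (a b : ℝ) :
    Integrable (fun h : I → ℝ => exp (a * h i + b * h j)) μ ∧
    ∫ h, exp (a * h i + b * h j) ∂μ = exp ((a ^ 2 * v + 2 * a * b * Δ i j + b ^ 2 * v) / 2) := by
  have h := hG.pair i j a b
  constructor
  · have h3 := integrable_exp_mul_gaussianReal (μ := 0)
      (v := (a ^ 2 * v + 2 * a * b * Δ i j + b ^ 2 * v).toNNReal) 1
    rw [← h, integrable_map_measure (by fun_prop) (by fun_prop)] at h3
    refine h3.congr (ae_of_all _ fun h => ?_)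
    simp
  · have h2 := mgf_gaussianReal h 1
    simp only [mgf, one_mul, zero_mul, zero_add, one_pow, mul_one] at h2
    rw [h2, Real.coe_toNNReal]
    have h1 := abs_le.1 (hG.bd i j)
    have hv := hG.vpos
    rcases le_total 0 (a * b) with h | h
    · nlinarith [sq_nonneg (a - b)]
    · nlinarith [sq_nonneg (a + b)]

end GV

/-- Running maximum of `h` along the path `x` up to time `N`. -/
noncomputable def Mx {I : Type} (x : ℕ → I) (N : ℕ) (h : I → ℝ) : ℝ :=
  (range (N + 1)).sup' (Finset.nonempty_range_add_one) (fun i => h (x i))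

/-- Event (for level `z`): index `j` is the first maximiser. -/
def argS {I : Type} (x : ℕ → I) (N j : ℕ) (z : ℝ) : Set (I → ℝ) :=
  {h | ∀ i ∈ range (N + 1), (i < j → h (x i) < z) ∧ (j ≤ i → h (x i) ≤ z)}

/-- Density of the law of the maximum with respect to the one-point Gaussian law. -/
noncomputable def Gd {I : Type} [Fintype I] (μ : Measure (I → ℝ)) (Δ : I → I → ℝ) (v : ℝ)
    (x : ℕ → I) (N : ℕ) (z : ℝ) : ENNReal :=
  ∑ j ∈ range (N + 1),
    μ {h | (fun i => h i + (z - h (x j)) * (Δ i (x j) / v)) ∈ argS x N j z}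

lemma Mx_arg {I : Type} (x : ℕ → I) (N : ℕ) (h : I → ℝ) :
    ∃ j ∈ range (N + 1), ∀ k ∈ range (N + 1), (h ∈ argS x N k (h (x k)) ↔ k = j) ∧
      Mx x N h = h (x j) := by
  classical
  have hne : ∃ j, j ∈ range (N + 1) ∧ Mx x N h = h (x j) := by
    obtain ⟨j, hj, e⟩ := Finset.exists_mem_eq_sup' (s := range (N + 1)) (Finset.nonempty_range_add_one)
      (fun i => h (x i))
    exact ⟨j, hj, e⟩
  have hle : ∀ i ∈ range (N + 1), h (x i) ≤ Mx x N h := fun i hi =>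
    Finset.le_sup' (fun i => h (x i)) hi
  refine ⟨Nat.find hne, (Nat.find_spec hne).1, fun k hk => ⟨⟨fun hk' => ?_, ?_⟩,
    (Nat.find_spec hne).2⟩⟩
  · have h1 := (Nat.find_spec hne)
    set j := Nat.find hne with hj
    rcases lt_trichotomy k j with hkj | hkj | hkj
    · exfalso
      have h2 := (hk' j h1.1).2 hkj.le
      have h3 : Mx x N h = h (x k) := le_antisymm (h1.2 ▸ h2) (hle k hk)
      exact Nat.find_min hne hkj ⟨hk, h3⟩
    · exact hkj
    · exfalso
      have h2 := (hk' j h1.1).1 hkj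
      have := hle k hk
      linarith [h1.2]
  · rintro rfl
    have h1 := (Nat.find_spec hne)
    intro i hi
    have h4 := hle i hi
    refine ⟨fun hij => ?_, fun _ => ?_⟩
    · rcases lt_or_eq_of_le h4 with h5 | h5
      · linarith [h1.2]
      · exact absurd ⟨hi, h5.symm⟩ (Nat.find_min hne hij)
    · linarith [h1.2]

lemma measurable_Mx {I : Type} (x : ℕ → I) (N : ℕ) : Measurable (Mx x N) := by
  unfold Mx
  have : (fun h : I → ℝ => (range (N + 1)).sup' (Finset.nonempty_range_add_one) (fun i => h (x i))) =
      (range (N + 1)).sup' (Finset.nonempty_range_add_one) (fun i => fun h : I → ℝ => h (x i)) := by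
    funext h; rw [Finset.sup'_apply]
  rw [this]
  exact Finset.measurable_sup' _ (fun i _ => measurable_pi_apply _)

namespace GV
variable {I : Type} [Fintype I] {μ : Measure (I → ℝ)} {Δ : I → I → ℝ} {v : ℝ}

lemma measurableSet_arg (x : ℕ → I) (N j : ℕ) :
    MeasurableSet {q : ℝ × (I → ℝ) | q.2 ∈ argS x N j q.1} := by
  have : {q : ℝ × (I → ℝ) | q.2 ∈ argS x N j q.1} = ⋂ i ∈ range (N + 1),
      ({q : ℝ × (I → ℝ) | i < j → q.2 (x i) < q.1} ∩ {q | j ≤ i → q.2 (x i) ≤ q.1}) := by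
    ext q; simp [argS]
  rw [this]
  refine Finset.measurableSet_biInter _ fun i _ => MeasurableSet.inter ?_ ?_
  · by_cases h : i < j
    · simp only [h, true_imp_iff]
      exact measurableSet_lt (by fun_prop) (by fun_prop)
    · simp [h]
  · by_cases h : j ≤ i
    · simp only [h, true_imp_iff]
      exact measurableSet_le (by fun_prop) (by fun_prop)
    · simp [h]

lemma Gd_mono (hG : GV μ Δ v) (x : ℕ → I) (N : ℕ) : Monotone (Gd μ Δ v x N) := by
  intro a b hab
  unfold Gd
  refine Finset.sum_le_sum fun j _ => measure_mono fun h hh i hi => ?_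
  have h1 := hh i hi
  have h2 : Δ (x i) (x j) / v ≤ 1 := by
    rw [div_le_one hG.vpos]; exact (abs_le.1 (hG.bd _ _)).2
  simp only at h1 ⊢
  refine ⟨fun hij => ?_, fun hij => ?_⟩
  · have := h1.1 hij; nlinarith
  · have := h1.2 hij; nlinarith

lemma Gd_le (hG : GV μ Δ v) (x : ℕ → I) (N : ℕ) (z : ℝ) : Gd μ Δ v x N z ≤ (N + 1 : ℕ) := by
  have := hG.prob
  unfold Gd
  calc _ ≤ ∑ j ∈ range (N + 1), (1 : ENNReal) := Finset.sum_le_sum fun j _ => prob_le_one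
    _ = _ := by simp

lemma lint_max (hG : GV μ Δ v) (x : ℕ → I) (N : ℕ) (φ : ℝ → ENNReal) (hφ : Measurable φ) :
    ∫⁻ h, φ (Mx x N h) ∂μ = ∫⁻ z, φ z * Gd μ Δ v x N z ∂(gaussianReal 0 v.toNNReal) := by
  classical
  have hind : ∀ j, Measurable (Function.uncurry (fun (z : ℝ) (h : I → ℝ) =>
      φ z * (argS x N j z).indicator (1 : (I → ℝ) → ENNReal) h)) := fun j => by
    unfold Function.uncurry
    refine (hφ.comp measurable_fst).mul ?_
    exact (measurable_one.indicator (measurableSet_arg x N j) :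
      Measurable ({q : ℝ × (I → ℝ) | q.2 ∈ argS x N j q.1}.indicator (1 : ℝ × (I → ℝ) → ENNReal)))
  have e1 : ∀ h : I → ℝ, φ (Mx x N h) =
      ∑ j ∈ range (N + 1), φ (h (x j)) * (argS x N j (h (x j))).indicator 1 h := fun h => by
    obtain ⟨j, hj, H⟩ := Mx_arg x N h
    rw [Finset.sum_eq_single j]
    · rw [Set.indicator_of_mem (((H j hj).1).2 rfl), (H j hj).2]; simp
    · intro k hk hkj
      rw [Set.indicator_of_notMem (fun hh => hkj (((H k hk).1).1 hh))]; simp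
    · intro h'; exact absurd hj h'
  simp_rw [e1]
  rw [lintegral_finsetSum']
  swap
  · intro j _
    have : Measurable (fun h : I → ℝ => φ (h (x j)) *
      (argS x N j (h (x j))).indicator (1 : (I → ℝ) → ENNReal) h) :=
      (hind j).comp (g := fun q : ℝ × (I → ℝ) => _)
        (f := fun h : I → ℝ => (h (x j), h)) (by fun_prop)
    exact this.aemeasurable
  unfold Gd
  simp_rw [Finset.mul_sum]
  have e2 : ∀ j z, ∫⁻ h, φ z * (argS x N j z).indicator (1 : (I → ℝ) → ENNReal)
      (fun i => h i + (z - h (x j)) * (Δ i (x j) / v)) ∂μ =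
      φ z * μ {h | (fun i => h i + (z - h (x j)) * (Δ i (x j) / v)) ∈ argS x N j z} := by
    intro j z
    have hm : MeasurableSet {h : I → ℝ |
        (fun i => h i + (z - h (x j)) * (Δ i (x j) / v)) ∈ argS x N j z} := by
      have := (measurableSet_arg x N j).preimage (f := fun h : I → ℝ =>
        (z, fun i => h i + (z - h (x j)) * (Δ i (x j) / v))) (by fun_prop)
      exact this
    rw [← lintegral_indicator_one hm, ← lintegral_const_mul _ (measurable_one.indicator hm)]
    rfl
  rw [lintegral_finsetSum']
  · refine Finset.sum_congr rfl fun j _ => ?_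
    rw [hG.lint_cond (x j) (fun (z : ℝ) (h : I → ℝ) =>
      φ z * (argS x N j z).indicator (1 : (I → ℝ) → ENNReal) h) (hind j)]
    exact lintegral_congr fun z => e2 j z
  · intro j _
    simp_rw [← e2]
    refine Measurable.aemeasurable ?_
    have := hG.prob
    refine Measurable.lintegral_prod_right' (f := fun q : ℝ × (I → ℝ) =>
      φ q.1 * (argS x N j q.1).indicator (1 : (I → ℝ) → ENNReal)
      (fun i => q.2 i + (q.1 - q.2 (x j)) * (Δ i (x j) / v))) ?_
    exact (hind j).comp (f := fun q : ℝ × (I → ℝ) =>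
      (q.1, fun i => q.2 i + (q.1 - q.2 (x j)) * (Δ i (x j) / v))) (by fun_prop)

lemma measurable_Gd (hG : GV μ Δ v) (x : ℕ → I) (N : ℕ) : Measurable (Gd μ Δ v x N) :=
  (hG.Gd_mono x N).measurable

/-- Tail of the maximum. -/
lemma max_tail (hG : GV μ Δ v) (x : ℕ → I) (N : ℕ) (b : ℝ) :
    μ {h | b < Mx x N h} = ∫⁻ z in Set.Ioi b, Gd μ Δ v x N z ∂(gaussianReal 0 v.toNNReal) := by
  have h := hG.lint_max x N ((Set.Ioi b).indicator 1) (measurable_one.indicator measurableSet_Ioi)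
  have e : {h | b < Mx x N h} = (Mx x N) ⁻¹' (Set.Ioi b) := rfl
  rw [e, ← lintegral_indicator_one (measurable_Mx x N measurableSet_Ioi),
    ← lintegral_indicator measurableSet_Ioi]
  refine Eq.trans ?_ (h.trans ?_)
  · rfl
  · refine lintegral_congr fun z => ?_
    by_cases hz : z ∈ Set.Ioi b <;> simp [hz]

lemma max_exp (hG : GV μ Δ v) (x : ℕ → I) (N : ℕ) (l : ℝ) :
    ∫⁻ h, ENNReal.ofReal (exp (l * Mx x N h)) ∂μ =
      ENNReal.ofReal (exp (l ^ 2 * v / 2)) *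
        ∫⁻ z, Gd μ Δ v x N z ∂(gaussianReal (l * v) v.toNNReal) := by
  rw [hG.lint_max x N (fun z => ENNReal.ofReal (exp (l * z))) (by fun_prop),
    gauss_tilt v hG.vpos l _ (hG.measurable_Gd x N)]

end GV

/-- Maximum of `h` along the times in `s` of the path `x`. -/
noncomputable def MS {I : Type} (x : ℕ → I) (s : Finset ℕ) (hs : s.Nonempty) (h : I → ℝ) : ℝ :=
  s.sup' hs (fun i => h (x i))

lemma MS_le {I : Type} (x : ℕ → I) (s : Finset ℕ) (hs : s.Nonempty) (h : I → ℝ) {i : ℕ}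
    (hi : i ∈ s) : h (x i) ≤ MS x s hs h := Finset.le_sup' (fun i => h (x i)) hi

lemma MS_mem {I : Type} (x : ℕ → I) (s : Finset ℕ) (hs : s.Nonempty) (h : I → ℝ) :
    ∃ i ∈ s, MS x s hs h = h (x i) := Finset.exists_mem_eq_sup' hs (fun i => h (x i))

lemma MS_shift {I : Type} (x : ℕ → I) (s : Finset ℕ) (hs : s.Nonempty) (h h' : I → ℝ) (a : ℝ)
    (H : ∀ i ∈ s, h (x i) ≤ h' (x i) + a) : MS x s hs h ≤ MS x s hs h' + a := by
  obtain ⟨i, hi, e⟩ := MS_mem x s hs h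
  have := MS_le x s hs h' hi
  have := H i hi
  linarith

lemma Mx_eq {I : Type} (x : ℕ → I) (N : ℕ) :
    Mx x N = MS x (range (N + 1)) nonempty_range_add_one := rfl

lemma measurable_MS {I : Type} (x : ℕ → I) (s : Finset ℕ) (hs : s.Nonempty) :
    Measurable (MS x s hs) := by
  unfold MS
  have : (fun h : I → ℝ => s.sup' hs (fun i => h (x i))) =
      s.sup' hs (fun i => fun h : I → ℝ => h (x i)) := by
    funext h; rw [Finset.sup'_apply]
  rw [this]
  exact Finset.measurable_sup' _ (fun i _ => measurable_pi_apply _)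

lemma Mx_succ {I : Type} (x : ℕ → I) (k : ℕ) (h : I → ℝ) :
    Mx x (k + 1) h = max (Mx x k h) (h (x (k + 1))) := by
  refine le_antisymm ?_ (max_le ?_ ?_)
  · obtain ⟨i, hi, e⟩ := MS_mem x (range (k + 1 + 1)) nonempty_range_add_one h
    rw [Mx_eq, e]
    by_cases hik : i = k + 1
    · subst hik; exact le_max_right _ _
    · refine le_max_of_le_left (MS_le x (range (k + 1)) nonempty_range_add_one h ?_)
      simp at hi ⊢; omega
  · obtain ⟨i, hi, e⟩ := MS_mem x (range (k + 1)) nonempty_range_add_one h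
    rw [Mx_eq, e]
    refine MS_le x (range (k + 1 + 1)) nonempty_range_add_one h ?_
    simp at hi ⊢; omega
  · exact MS_le x (range (k + 1 + 1)) nonempty_range_add_one h (by simp)

lemma Mx_zero {I : Type} (x : ℕ → I) (h : I → ℝ) : Mx x 0 h = h (x 0) := by
  simp [Mx]

lemma path_up {I : Type} (x : ℕ → I) (l : ℝ) (hl : 0 ≤ l) (h : I → ℝ) (N : ℕ) :
    exp (l * Mx x N h) ≤ exp (l * h (x 0)) +
      ∑ k ∈ range N, exp (l * h (x (k + 1))) * (l * (Mx x (k + 1) h - Mx x k h)) := by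
  induction N with
  | zero => simp [Mx_zero]
  | succ k ih =>
    rw [Finset.sum_range_succ]
    rw [Mx_succ]
    rcases le_total (h (x (k + 1))) (Mx x k h) with h1 | h1
    · rw [max_eq_left h1]; simpa using ih
    · rw [max_eq_right h1]
      have h2 := add_one_le_exp (l * Mx x k h - l * h (x (k + 1)))
      have h3 : exp (l * Mx x k h) =
        exp (l * h (x (k + 1))) * exp (l * Mx x k h - l * h (x (k + 1))) := by
        rw [← exp_add]; congr 1; ring
      have h4 := exp_pos (l * h (x (k + 1)))
      nlinarith

lemma exp_lower (y η : ℝ) (hy : 0 ≤ y) (hη : 0 < η) :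
    (1 - η / 2) * y - y ^ 4 / (2 * η ^ 2) ≤ 1 - exp (-y) := by
  have h1 : exp (-y) ≤ 1 - y + y ^ 2 / 2 := by
    have h2 := Real.quadratic_le_exp_of_nonneg hy
    have h3 : exp (-y) * exp y = 1 := by rw [← exp_add]; simp
    have h5 := exp_pos (-y)
    have h4 : exp (-y) * (1 + y + y ^ 2 / 2) ≤ 1 := by nlinarith
    have h6 : 1 ≤ (1 - y + y ^ 2 / 2) * (1 + y + y ^ 2 / 2) := by nlinarith [sq_nonneg (y ^ 2)]
    have h7 : 0 < 1 + y + y ^ 2 / 2 := by positivity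
    exact le_of_mul_le_mul_right (h4.trans h6) h7
  have h8 : y ^ 2 ≤ η * y + y ^ 4 / η ^ 2 := by
    rcases le_total y η with h | h
    · have : 0 ≤ y ^ 4 / η ^ 2 := by positivity
      nlinarith
    · have : y ^ 2 ≤ y ^ 4 / η ^ 2 := by
        rw [le_div_iff₀ (by positivity)]
        have : η ^ 2 ≤ y ^ 2 := by gcongr
        nlinarith [sq_nonneg y]
      nlinarith
  have h9 : y ^ 4 / (2 * η ^ 2) = y ^ 4 / η ^ 2 / 2 := by field_simp
  rw [h9]; nlinarith

lemma path_low {I : Type} (x : ℕ → I) (l : ℝ) (hl : 0 ≤ l) (h : I → ℝ) (L N : ℕ) :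
    ∑ k ∈ range N, (exp (l * h (x (k + 1))) * (1 - exp (-(l *
        (MS x (Icc (k - L) (k + 1)) ⟨k, by simp⟩ h - MS x (Icc (k - L) k) ⟨k, by simp⟩ h)))) -
      ∑ i ∈ range (k - L), exp (l / 2 * h (x i) + l / 2 * h (x (k + 1)))) ≤
      exp (l * Mx x N h) := by
  induction N with
  | zero => simp [exp_nonneg]
  | succ k ih =>
    rw [Finset.sum_range_succ]
    refine le_trans (add_le_add_left ih _) ?_
    set Z := h (x (k + 1)) with hZ
    set W := MS x (Icc (k - L) k) ⟨k, by simp⟩ h with hW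
    have hE : MS x (Icc (k - L) (k + 1)) ⟨k, by simp⟩ h ≤ max W Z := by
      obtain ⟨i, hi, e⟩ := MS_mem x (Icc (k - L) (k + 1)) ⟨k, by simp⟩ h
      rw [e]
      by_cases hik : i = k + 1
      · subst hik; exact le_max_right _ _
      · refine le_max_of_le_left (MS_le x (Icc (k - L) k) ⟨k, by simp⟩ h ?_)
        simp at hi ⊢; omega
    have hE2 : W ≤ MS x (Icc (k - L) (k + 1)) ⟨k, by simp⟩ h := by
      obtain ⟨i, hi, e⟩ := MS_mem x (Icc (k - L) k) ⟨k, by simp⟩ h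
      rw [hW, e]
      refine MS_le x _ _ h ?_
      simp at hi ⊢; omega
    set E := MS x (Icc (k - L) (k + 1)) ⟨k, by simp⟩ h
    have hsum : 0 ≤ ∑ i ∈ range (k - L), exp (l / 2 * h (x i) + l / 2 * Z) :=
      Finset.sum_nonneg fun _ _ => exp_nonneg _
    have hX := exp_pos (l * Z)
    obtain ⟨i, hi, e⟩ := MS_mem x (range (k + 1)) nonempty_range_add_one h
    rw [← Mx_eq] at e
    rw [Mx_succ, ← hZ]
    rcases le_total Z W with h1 | h1
    · have : E = W := le_antisymm (by simpa [h1] using hE) hE2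
      rw [this]
      have : exp (l * Mx x k h) ≤ exp (l * max (Mx x k h) Z) := by
        gcongr; exact le_max_left _ _
      simp; linarith
    · have hEZ : E ≤ Z := by simpa [h1] using hE
      have hb : exp (l * Z) * (1 - exp (-(l * (E - W)))) ≤ exp (l * Z) - exp (l * W) := by
        have : exp (l * W) ≤ exp (l * Z) * exp (-(l * (E - W))) := by
          rw [← exp_add]; gcongr; nlinarith
        linarith
      by_cases hik : k - L ≤ i
      · have h2 : Mx x k h ≤ W := by
          rw [e]; refine MS_le x _ _ h ?_; simp at hi ⊢; omega
        have : exp (l * Mx x k h) ≤ exp (l * W) := by gcongr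
        have : exp (l * Z) ≤ exp (l * max (Mx x k h) Z) := by gcongr; exact le_max_right _ _
        linarith
      · have h2 : exp (l / 2 * h (x i) + l / 2 * Z) ≤
            ∑ i ∈ range (k - L), exp (l / 2 * h (x i) + l / 2 * Z) :=
          Finset.single_le_sum (f := fun i => exp (l / 2 * h (x i) + l / 2 * Z))
            (fun _ _ => exp_nonneg _) (by simp; omega)
        rw [← e] at h2
        have hw := exp_pos (l * W)
        rcases le_total (Mx x k h) Z with h3 | h3
        · rw [max_eq_right h3]
          have : exp (l * Mx x k h) ≤ exp (l / 2 * Mx x k h + l / 2 * Z) := by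
            gcongr; nlinarith
          linarith
        · rw [max_eq_left h3]
          have : exp (l * Z) ≤ exp (l / 2 * Mx x k h + l / 2 * Z) := by
            gcongr; nlinarith
          linarith

namespace GV
variable {I : Type} [Fintype I] {μ : Measure (I → ℝ)} {Δ : I → I → ℝ} {v : ℝ}

lemma integrable_coord (hG : GV μ Δ v) (i : I) : Integrable (fun h : I → ℝ => h i) μ := by
  have := hG.prob
  exact (hG.memLp i).integrable (by norm_num)

lemma integrable_MS (hG : GV μ Δ v) (x : ℕ → I) (s : Finset ℕ) (hs : s.Nonempty) (d : I → ℝ) :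
    Integrable (fun h => MS x s hs (fun i => h i + d i)) μ := by
  have := hG.prob
  have hi : Integrable (fun h : I → ℝ => ∑ i ∈ s, |h (x i) + d (x i)|) μ :=
    integrable_finsetSum _ fun i _ =>
      ((hG.integrable_coord (x i)).add (integrable_const (d (x i)))).abs
  refine hi.mono' ?_ (ae_of_all _ fun h => ?_)
  · exact ((measurable_MS x s hs).comp (by fun_prop)).aestronglyMeasurable
  · obtain ⟨i, hi, e⟩ := MS_mem x s hs (fun i => h i + d i)
    rw [e, Real.norm_eq_abs]
    exact Finset.single_le_sum (f := fun i => |h (x i) + d (x i)|) (fun _ _ => abs_nonneg _) hi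

lemma integrable_exp (hG : GV μ Δ v) (l : ℝ) (i : I) :
    Integrable (fun h : I → ℝ => exp (l * h i)) μ := by
  simpa using (hG.exp_pair i i l 0).1

lemma integral_exp (hG : GV μ Δ v) (l : ℝ) (i : I) :
    ∫ h : I → ℝ, exp (l * h i) ∂μ = exp (l ^ 2 * v / 2) := by
  simpa using (hG.exp_pair i i l 0).2

lemma integrable_exp_Mx (hG : GV μ Δ v) (x : ℕ → I) (N : ℕ) (l : ℝ) :
    Integrable (fun h => exp (l * Mx x N h)) μ := by
  have hi : Integrable (fun h : I → ℝ => ∑ i ∈ range (N + 1), exp (l * h (x i))) μ :=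
    integrable_finsetSum _ fun i _ => hG.integrable_exp l (x i)
  refine hi.mono' ?_ (ae_of_all _ fun h => ?_)
  · have := measurable_Mx x N
    exact (by fun_prop : Measurable (fun h => exp (l * Mx x N h))).aestronglyMeasurable
  · obtain ⟨i, hi, e⟩ := MS_mem x (range (N + 1)) nonempty_range_add_one h
    rw [Mx_eq, e, Real.norm_eq_abs, abs_of_pos (exp_pos _)]
    exact Finset.single_le_sum (f := fun i => exp (l * h (x i))) (fun _ _ => exp_nonneg _) hi

lemma integral_Mx_le (hG : GV μ Δ v) (x : ℕ → I) (N : ℕ) :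
    ∫ h, Mx x N h ∂μ ≤ √((N + 1) * v) := by
  have := hG.prob
  have hv := hG.vpos
  set a := √((N + 1) * v) with ha
  have hapos : 0 < a := by positivity
  have ha2 : a ^ 2 = (N + 1) * v := Real.sq_sqrt (by positivity)
  have hsq : ∀ i : I, Integrable (fun h : I → ℝ => (h i) ^ 2) μ := fun i => (hG.memLp i).integrable_sq
  have hsq2 : ∀ i : I, ∫ h : I → ℝ, (h i) ^ 2 ∂μ = v := fun i => by
    have h1 := hG.var_pair i i 1 0
    simp only [one_mul, zero_mul, add_zero, mul_zero, one_pow] at h1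
    rw [variance_of_integral_eq_zero (measurable_pi_apply i).aemeasurable (hG.mean i)] at h1
    rw [h1]; ring
  have hI : Integrable (fun h : I → ℝ => a / 2 + (∑ i ∈ range (N + 1), (h (x i)) ^ 2) / (2 * a)) μ :=
    (integrable_const _).add ((integrable_finsetSum _ fun i _ => hsq (x i)).div_const _)
  have hM : Integrable (Mx x N) μ := by
    simpa [Mx_eq] using hG.integrable_MS x (range (N + 1)) nonempty_range_add_one (fun _ => 0)
  calc ∫ h, Mx x N h ∂μ ≤ ∫ h, (a / 2 + (∑ i ∈ range (N + 1), (h (x i)) ^ 2) / (2 * a)) ∂μ := by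
        refine integral_mono hM hI fun h => ?_
        obtain ⟨i, hi, e⟩ := MS_mem x (range (N + 1)) nonempty_range_add_one h
        have h1 : (h (x i)) ^ 2 ≤ ∑ i ∈ range (N + 1), (h (x i)) ^ 2 :=
          Finset.single_le_sum (f := fun i => (h (x i)) ^ 2) (fun _ _ => sq_nonneg _) hi
        simp only
        rw [Mx_eq, e]
        have h2 : h (x i) ≤ a / 2 + (h (x i)) ^ 2 / (2 * a) := by
          have : a / 2 + (h (x i)) ^ 2 / (2 * a) - h (x i) = (a - h (x i)) ^ 2 / (2 * a) := by
            field_simp; ring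
          have h3 : 0 ≤ (a - h (x i)) ^ 2 / (2 * a) := by positivity
          linarith
        have h4 : (h (x i)) ^ 2 / (2 * a) ≤ (∑ i ∈ range (N + 1), (h (x i)) ^ 2) / (2 * a) := by
          gcongr
        linarith
    _ = a / 2 + (∑ i ∈ range (N + 1), v) / (2 * a) := by
        rw [integral_add (integrable_const _)
          ((integrable_finsetSum _ fun i _ => hsq (x i)).div_const _),
          integral_div (2 * a) (fun h : I → ℝ => ∑ i ∈ range (N + 1), (h (x i)) ^ 2),
          integral_finsetSum _ (fun i _ => hsq (x i))]
        simp [hsq2]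
    _ = a := by
        rw [Finset.sum_const, card_range, nsmul_eq_mul]
        push_cast
        rw [← ha2]; field_simp; norm_num

/-- Upper bound for the exponential moment of the maximum. -/
lemma up (hG : GV μ Δ v) (x : ℕ → I) (N : ℕ) (l K : ℝ) (hl : 0 ≤ l)
    (hK : ∀ k < N, ∀ i, |Δ i (x k) - Δ i (x (k + 1))| ≤ K) :
    ∫ h, exp (l * Mx x N h) ∂μ ≤
      exp (l ^ 2 * v / 2) * (1 + l * √((N + 1) * v) + N * K * l ^ 2) := by
  have := hG.prob
  set m : ℕ → ℝ := fun k => ∫ h, Mx x k (fun i => h i + l * Δ i (x k)) ∂μ with hm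
  have hMi : ∀ (k : ℕ) (d : I → ℝ), Integrable (fun h => Mx x k (fun i => h i + d i)) μ := fun k d =>
    hG.integrable_MS x (range (k + 1)) nonempty_range_add_one d
  have hmeas : ∀ k, Measurable (Mx x k) := measurable_Mx x
  have hF : ∀ k, Measurable (fun h => l * (Mx x (k + 1) h - Mx x k h)) := fun k => by
    have := hmeas k; have := hmeas (k + 1); fun_prop
  have hFi : ∀ k, Integrable (fun h => (fun h => l * (Mx x (k + 1) h - Mx x k h))
      (fun i => h i + l * Δ i (x (k + 1)))) μ := fun k => by
    exact ((hMi (k + 1) (fun i => l * Δ i (x (k + 1)))).sub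
      (hMi k (fun i => l * Δ i (x (k + 1))))).const_mul l
  have hti : ∀ k, Integrable (fun h : I → ℝ => exp (l * h (x (k + 1))) *
      (l * (Mx x (k + 1) h - Mx x k h))) μ := fun k =>
    hG.tilt_integrable (x (k + 1)) l _ (hF k) (hFi k)
  have hval : ∀ k < N, ∫ h : I → ℝ, exp (l * h (x (k + 1))) *
      (l * (Mx x (k + 1) h - Mx x k h)) ∂μ ≤ exp (l ^ 2 * v / 2) * (l * (m (k + 1) - m k + l * K)) := by
    intro k hk
    rw [hG.tilt_int (x (k + 1)) l _ (hF k)]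
    gcongr
    rw [integral_const_mul, integral_sub (hMi (k + 1) (fun i => l * Δ i (x (k + 1))))
      (hMi k (fun i => l * Δ i (x (k + 1))))]
    gcongr
    have : m k ≤ ∫ h, (Mx x k (fun i => h i + l * Δ i (x (k + 1))) + l * K) ∂μ := by
      refine integral_mono (hMi k (fun i => l * Δ i (x k))) ((hMi k (fun i => l * Δ i (x (k + 1)))).add
        (integrable_const _)) fun h => ?_
      simp only [Mx_eq]
      refine MS_shift x _ _ _ _ _ fun i _ => ?_
      have := (abs_le.1 (hK k hk (x i))).2
      nlinarith
    rw [integral_add (hMi k (fun i => l * Δ i (x (k + 1)))) (integrable_const _)] at this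
    simp at this
    simp only [hm] at this ⊢
    linarith
  have hm0 : m 0 = l * v := by
    simp only [hm, Mx_zero]
    rw [integral_add (hG.integrable_coord _) (integrable_const _), hG.mean, hG.diag]; simp
  have hmN : m N ≤ l * v + √((N + 1) * v) := by
    have h0 : Integrable (Mx x N) μ := by simpa using hMi N (fun _ => 0)
    have : m N ≤ ∫ h, (Mx x N h + l * v) ∂μ := by
      refine integral_mono (hMi N (fun i => l * Δ i (x N))) (h0.add
        (integrable_const _)) fun h => ?_
      simp only [Mx_eq]
      refine MS_shift x (range (N + 1)) nonempty_range_add_one _ h (l * v) fun i _ => ?_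
      have := (abs_le.1 (hG.bd (x i) (x N))).2
      nlinarith
    rw [integral_add h0 (integrable_const _)] at this
    simp at this
    linarith [hG.integral_Mx_le x N]
  have hsumI : Integrable (fun h : I → ℝ => ∑ k ∈ range N, exp (l * h (x (k + 1))) *
      (l * (Mx x (k + 1) h - Mx x k h))) μ := integrable_finsetSum _ fun k _ => hti k
  calc ∫ h, exp (l * Mx x N h) ∂μ ≤ ∫ h : I → ℝ, (exp (l * h (x 0)) +
      ∑ k ∈ range N, exp (l * h (x (k + 1))) * (l * (Mx x (k + 1) h - Mx x k h))) ∂μ :=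
        integral_mono (hG.integrable_exp_Mx x N l) ((hG.integrable_exp _ _).add hsumI)
          fun h => path_up x l hl h N
    _ = exp (l ^ 2 * v / 2) + ∑ k ∈ range N, ∫ h : I → ℝ, exp (l * h (x (k + 1))) *
        (l * (Mx x (k + 1) h - Mx x k h)) ∂μ := by
        rw [integral_add (hG.integrable_exp _ _) hsumI, hG.integral_exp,
          integral_finsetSum _ fun k _ => hti k]
    _ ≤ exp (l ^ 2 * v / 2) + ∑ k ∈ range N,
          exp (l ^ 2 * v / 2) * (l * (m (k + 1) - m k + l * K)) := by
        gcongr with k hk; exact hval k (by simpa using hk)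
    _ = exp (l ^ 2 * v / 2) * (1 + l * (m N - m 0) + N * K * l ^ 2) := by
        rw [← Finset.mul_sum, ← Finset.mul_sum, Finset.sum_add_distrib, Finset.sum_range_sub]
        simp; ring
    _ ≤ _ := by
        rw [hm0]; gcongr; linarith

end GV

lemma pow4_le (s : ℝ) : s ^ 4 ≤ 24 * (exp s + exp (-s)) := by
  have key : ∀ y : ℝ, 0 ≤ y → y ^ 4 ≤ 24 * exp y := fun y hy => by
    have := Real.pow_div_factorial_le_exp y hy 4
    have h : ((Nat.factorial 4 : ℕ) : ℝ) = 24 := by norm_num [Nat.factorial]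
    rw [h, div_le_iff₀ (by norm_num)] at this
    linarith
  have h1 := exp_pos s
  have h2 := exp_pos (-s)
  rcases le_total 0 s with h | h
  · have := key s h; linarith
  · have := key (-s) (by linarith)
    have e : (-s) ^ 4 = s ^ 4 := by ring
    linarith

lemma sum_aux_low (N : ℕ) (E A B : ℝ) (κ S : ℕ → ℝ) :
    ∑ k ∈ range N, (A * κ k - B - E * S k) = A * ∑ k ∈ range N, κ k - N * B -
      E * ∑ k ∈ range N, S k := by
  rw [Finset.sum_sub_distrib, Finset.sum_sub_distrib, Finset.mul_sum, Finset.mul_sum]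
  simp

namespace GV
variable {I : Type} [Fintype I] {μ : Measure (I → ℝ)} {Δ : I → I → ℝ} {v : ℝ}

set_option maxHeartbeats 1600000 in
/-- Lower bound for the exponential moment of the maximum. -/
lemma low (hG : GV μ Δ v) (x : ℕ → I) (N L : ℕ) (l K η : ℝ) (hl : 0 ≤ l) (hl1 : l ≤ 1)
    (hη : 0 < η) (hη2 : η ≤ 2) (κ : ℕ → ℝ)
    (hK : ∀ k < N, v - Δ (x k) (x (k + 1)) ≤ K)
    (hκ : ∀ k < N, ∀ i ∈ Icc (k - L) k, Δ (x i) (x (k + 1)) - Δ (x i) (x k) ≤ κ k) :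
    exp (l ^ 2 * v / 2) * ((1 - η / 2) * l ^ 2 * (- ∑ k ∈ range N, κ k) -
        N * (l ^ 4 / (2 * η ^ 2) * (48 * exp (2 * K))) -
        ∑ k ∈ range N, ∑ i ∈ range (k - L), exp (-(l ^ 2 / 4 * (v - Δ (x i) (x (k + 1))))))
      ≤ ∫ h, exp (l * Mx x N h) ∂μ := by
  have := hG.prob
  have hv := hG.vpos
  set Me : ℕ → (I → ℝ) → ℝ := fun k h => MS x (Icc (k - L) (k + 1)) ⟨k, by simp⟩ h with hMe
  set Mw : ℕ → (I → ℝ) → ℝ := fun k h => MS x (Icc (k - L) k) ⟨k, by simp⟩ h with hMw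
  have hMem : ∀ k, Measurable (Me k) := fun k => measurable_MS _ _ _
  have hMwm : ∀ k, Measurable (Mw k) := fun k => measurable_MS _ _ _
  have hMei : ∀ (k : ℕ) (d : I → ℝ), Integrable (fun h => Me k (fun i => h i + d i)) μ :=
    fun k d => hG.integrable_MS x _ _ d
  have hMwi : ∀ (k : ℕ) (d : I → ℝ), Integrable (fun h => Mw k (fun i => h i + d i)) μ :=
    fun k d => hG.integrable_MS x _ _ d
  -- overshoot facts
  have ho0 : ∀ k h, 0 ≤ Me k h - Mw k h := fun k h => by
    obtain ⟨i, hi, e⟩ := MS_mem x (Icc (k - L) k) ⟨k, by simp⟩ h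
    have := MS_le x (Icc (k - L) (k + 1)) ⟨k, by simp⟩ h (i := i) (by simp at hi ⊢; omega)
    simp only [hMe, hMw]; rw [e]; linarith
  have ho1 : ∀ k h, Me k h - Mw k h ≤ |h (x (k + 1)) - h (x k)| := fun k h => by
    obtain ⟨i, hi, e⟩ := MS_mem x (Icc (k - L) (k + 1)) ⟨k, by simp⟩ h
    have h1 := MS_le x (Icc (k - L) k) ⟨k, by simp⟩ h (i := k) (by simp)
    simp only [hMe, hMw]; rw [e]
    by_cases hik : i = k + 1
    · subst hik
      have := le_abs_self (h (x (k + 1)) - h (x k)); linarith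
    · have h2 := MS_le x (Icc (k - L) k) ⟨k, by simp⟩ h (i := i) (by simp at hi ⊢; omega)
      have := abs_nonneg (h (x (k + 1)) - h (x k)); linarith
  -- fourth moment
  have hstep : ∀ k < N, Integrable (fun h => (Me k (fun i => h i + l * Δ i (x (k + 1))) -
        Mw k (fun i => h i + l * Δ i (x (k + 1)))) ^ 4) μ ∧
      ∫ h, (Me k (fun i => h i + l * Δ i (x (k + 1))) -
        Mw k (fun i => h i + l * Δ i (x (k + 1)))) ^ 4 ∂μ ≤ 48 * exp (2 * K) := by
    intro k hk
    set D := v - Δ (x k) (x (k + 1)) with hD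
    have hDK : D ≤ K := hK k hk
    have hD0 : 0 ≤ D := by have := (abs_le.1 (hG.bd (x k) (x (k + 1)))).2; linarith
    obtain ⟨i1, e1⟩ := hG.exp_pair (x (k + 1)) (x k) 1 (-1)
    obtain ⟨i2, e2⟩ := hG.exp_pair (x (k + 1)) (x k) (-1) 1
    have hb : ∀ h : I → ℝ, (Me k (fun i => h i + l * Δ i (x (k + 1))) -
        Mw k (fun i => h i + l * Δ i (x (k + 1)))) ^ 4 ≤
        24 * (exp (l * D) * exp (1 * h (x (k + 1)) + -1 * h (x k)) +
          exp (-(l * D)) * exp (-1 * h (x (k + 1)) + 1 * h (x k))) := fun h => by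
      have h1 := ho0 k (fun i => h i + l * Δ i (x (k + 1)))
      have h2 := ho1 k (fun i => h i + l * Δ i (x (k + 1)))
      set o := Me k (fun i => h i + l * Δ i (x (k + 1))) - Mw k (fun i => h i + l * Δ i (x (k + 1)))
      set s := h (x (k + 1)) + l * Δ (x (k + 1)) (x (k + 1)) - (h (x k) + l * Δ (x k) (x (k + 1)))
        with hs
      have h3 : o ^ 4 ≤ s ^ 4 := by
        have : o ^ 4 ≤ |s| ^ 4 := by gcongr
        rwa [Even.pow_abs (by decide)] at this
      refine (h3.trans (pow4_le s)).trans (le_of_eq ?_)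
      rw [← exp_add, ← exp_add]
      have : s = l * D + (1 * h (x (k + 1)) + -1 * h (x k)) := by
        rw [hs, hG.diag, hD]; ring
      rw [this]; congr 3; ring
    have hI : Integrable (fun h : I → ℝ => 24 * (exp (l * D) * exp (1 * h (x (k + 1)) + -1 * h (x k)) +
          exp (-(l * D)) * exp (-1 * h (x (k + 1)) + 1 * h (x k)))) μ :=
      ((i1.const_mul _).add (i2.const_mul _)).const_mul _
    have h_intg : Integrable (fun h => (Me k (fun i => h i + l * Δ i (x (k + 1))) -
        Mw k (fun i => h i + l * Δ i (x (k + 1)))) ^ 4) μ := by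
      refine hI.mono' ?_ (ae_of_all _ fun h => ?_)
      · have hsh : Measurable (fun (h : I → ℝ) (i : I) => h i + l * Δ i (x (k + 1))) := by fun_prop
        exact ((((hMem k).comp hsh).sub ((hMwm k).comp hsh)).pow_const 4).aestronglyMeasurable
      · rw [Real.norm_eq_abs, abs_of_nonneg (by positivity)]; exact hb h
    refine ⟨h_intg, (integral_mono h_intg hI hb).trans ?_⟩
    rw [integral_const_mul, integral_add (i1.const_mul _) (i2.const_mul _), integral_const_mul,
      integral_const_mul, e1, e2, ← exp_add, ← exp_add]
    have hsy := hG.symm (x (k + 1)) (x k)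
    have b1 : exp (l * D + (1 ^ 2 * v + 2 * 1 * -1 * Δ (x (k + 1)) (x k) + (-1) ^ 2 * v) / 2) ≤
        exp (2 * K) := by
      gcongr; rw [hsy]; nlinarith
    have b2 : exp (-(l * D) + ((-1) ^ 2 * v + 2 * -1 * 1 * Δ (x (k + 1)) (x k) + 1 ^ 2 * v) / 2) ≤
        exp (2 * K) := by
      gcongr; rw [hsy]; nlinarith
    linarith
  set f : ℝ → ℝ := fun o => (1 - η / 2) * (l * o) - l ^ 4 / (2 * η ^ 2) * o ^ 4 with hf
  set m : ℕ → ℝ := fun k => ∫ h, Mw k (fun i => h i + l * Δ i (x k)) ∂μ with hm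
  have hFm : ∀ k, Measurable (fun h => f (Me k h - Mw k h)) := fun k => by
    have hfm : Measurable f := by simp only [hf]; fun_prop
    exact hfm.comp ((hMem k).sub (hMwm k))
  have hFi : ∀ k < N, Integrable (fun h => (fun h => f (Me k h - Mw k h))
      (fun i => h i + l * Δ i (x (k + 1)))) μ := fun k hk => by
    simp only [hf]
    exact ((((hMei k (fun i => l * Δ i (x (k + 1)))).sub
      (hMwi k (fun i => l * Δ i (x (k + 1))))).const_mul l).const_mul _).sub
      ((hstep k hk).1.const_mul _)
  have hTi : ∀ k < N, Integrable (fun h : I → ℝ => exp (l * h (x (k + 1))) * f (Me k h - Mw k h)) μ :=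
    fun k hk => hG.tilt_integrable (x (k + 1)) l _ (hFm k) (hFi k hk)
  have hval : ∀ k < N, exp (l ^ 2 * v / 2) * ((1 - η / 2) * (l * (m (k + 1) - m k - l * κ k)) -
      l ^ 4 / (2 * η ^ 2) * (48 * exp (2 * K))) ≤
      ∫ h : I → ℝ, exp (l * h (x (k + 1))) * f (Me k h - Mw k h) ∂μ := by
    intro k hk
    rw [hG.tilt_int (x (k + 1)) l _ (hFm k)]
    gcongr
    simp only [hf]
    have ia := hMei k (fun i => l * Δ i (x (k + 1)))
    have ib := hMwi k (fun i => l * Δ i (x (k + 1)))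
    have iab : Integrable (fun h => Me k (fun i => h i + l * Δ i (x (k + 1))) -
        Mw k (fun i => h i + l * Δ i (x (k + 1)))) μ := ia.sub ib
    rw [integral_sub ((iab.const_mul l).const_mul _) ((hstep k hk).1.const_mul _),
      integral_const_mul, integral_const_mul, integral_const_mul, integral_sub ia ib]
    have hη' : 0 ≤ 1 - η / 2 := by linarith
    refine sub_le_sub ?_ (by gcongr; exact (hstep k hk).2)
    have c1 : m (k + 1) ≤ ∫ h, Me k (fun i => h i + l * Δ i (x (k + 1))) ∂μ := by
      refine integral_mono (hMwi (k + 1) (fun i => l * Δ i (x (k + 1)))) ia fun h => ?_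
      obtain ⟨i, hi, e⟩ := MS_mem x (Icc (k + 1 - L) (k + 1)) ⟨k + 1, by simp⟩
        (fun i => h i + l * Δ i (x (k + 1)))
      simp only [hMe, hMw]; rw [e]
      exact MS_le x (Icc (k - L) (k + 1)) ⟨k, by simp⟩ (fun i => h i + l * Δ i (x (k + 1)))
        (i := i) (by simp at hi ⊢; omega)
    have c2 : ∫ h, Mw k (fun i => h i + l * Δ i (x (k + 1))) ∂μ ≤ m k + l * κ k := by
      have : ∫ h, Mw k (fun i => h i + l * Δ i (x (k + 1))) ∂μ ≤
          ∫ h, (Mw k (fun i => h i + l * Δ i (x k)) + l * κ k) ∂μ := by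
        refine integral_mono ib ((hMwi k (fun i => l * Δ i (x k))).add (integrable_const _))
          fun h => ?_
        refine MS_shift x (Icc (k - L) k) ⟨k, by simp⟩ (fun i => h i + l * Δ i (x (k + 1)))
          (fun i => h i + l * Δ i (x k)) (l * κ k) fun i hi => ?_
        have := hκ k hk i hi
        nlinarith
      rw [integral_add (hMwi k (fun i => l * Δ i (x k))) (integrable_const _)] at this
      simpa using this
    exact mul_le_mul_of_nonneg_left (mul_le_mul_of_nonneg_left (by linarith) hl) hη'
  have hm0 : m 0 = l * v := by
    have : ∀ h : I → ℝ, Mw 0 (fun i => h i + l * Δ i (x 0)) = h (x 0) + l * v := fun h => by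
      obtain ⟨i, hi, e⟩ := MS_mem x (Icc (0 - L) 0) ⟨0, by simp⟩ (fun i => h i + l * Δ i (x 0))
      have hi0 : i = 0 := by simp at hi; omega
      simp only [hMw]; rw [e, hi0, hG.diag]
    simp only [hm, this]
    rw [integral_add (hG.integrable_coord _) (integrable_const _), hG.mean]; simp
  have hmN : l * v ≤ m N := by
    have : ∫ h : I → ℝ, (h (x N) + l * v) ∂μ ≤ m N := by
      refine integral_mono ((hG.integrable_coord _).add (integrable_const _))
        (hMwi N (fun i => l * Δ i (x N))) fun h => ?_
      have := MS_le x (Icc (N - L) N) ⟨N, by simp⟩ (fun i => h i + l * Δ i (x N)) (i := N) (by simp)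
      simpa [hG.diag] using this
    rw [integral_add (hG.integrable_coord _) (integrable_const _), hG.mean] at this
    simpa using this
  have hfar : ∀ i k, Integrable (fun h : I → ℝ => exp (l / 2 * h (x i) + l / 2 * h (x (k + 1)))) μ ∧
      ∫ h : I → ℝ, exp (l / 2 * h (x i) + l / 2 * h (x (k + 1))) ∂μ =
        exp (l ^ 2 * v / 2) * exp (-(l ^ 2 / 4 * (v - Δ (x i) (x (k + 1))))) := fun i k => by
    obtain ⟨a, b⟩ := hG.exp_pair (x i) (x (k + 1)) (l / 2) (l / 2)
    refine ⟨a, b.trans ?_⟩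
    rw [← exp_add]; congr 1; ring
  have hfarI : ∀ k, Integrable (fun h : I → ℝ => ∑ i ∈ range (k - L),
      exp (l / 2 * h (x i) + l / 2 * h (x (k + 1)))) μ := fun k =>
    integrable_finsetSum _ fun i _ => (hfar i k).1
  have hbr : ∀ k ∈ range N, Integrable (fun h : I → ℝ => exp (l * h (x (k + 1))) * f (Me k h - Mw k h) -
        ∑ i ∈ range (k - L), exp (l / 2 * h (x i) + l / 2 * h (x (k + 1)))) μ := fun k hk =>
    (hTi k (by simpa using hk)).sub (hfarI k)
  calc _ = ∑ k ∈ range N, (exp (l ^ 2 * v / 2) * ((1 - η / 2) * (l * ((l * v - l * v) / N - l * κ k)) -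
      l ^ 4 / (2 * η ^ 2) * (48 * exp (2 * K))) - ∑ i ∈ range (k - L),
      exp (l ^ 2 * v / 2) * exp (-(l ^ 2 / 4 * (v - Δ (x i) (x (k + 1)))))) := by
        have e : ∀ k ∈ range N, (exp (l ^ 2 * v / 2) * ((1 - η / 2) * (l * ((l * v - l * v) / N - l * κ k)) -
            l ^ 4 / (2 * η ^ 2) * (48 * exp (2 * K))) - ∑ i ∈ range (k - L),
            exp (l ^ 2 * v / 2) * exp (-(l ^ 2 / 4 * (v - Δ (x i) (x (k + 1)))))) =
            (-(exp (l ^ 2 * v / 2) * (1 - η / 2) * l ^ 2)) * κ k -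
            exp (l ^ 2 * v / 2) * (l ^ 4 / (2 * η ^ 2) * (48 * exp (2 * K))) -
            exp (l ^ 2 * v / 2) * ∑ i ∈ range (k - L),
              exp (-(l ^ 2 / 4 * (v - Δ (x i) (x (k + 1))))) := fun k _ => by
          rw [← Finset.mul_sum, sub_self, zero_div]; ring
        rw [Finset.sum_congr rfl e, sum_aux_low]
        ring
    _ ≤ ∑ k ∈ range N, (exp (l ^ 2 * v / 2) * ((1 - η / 2) * (l * (m (k + 1) - m k - l * κ k)) -
      l ^ 4 / (2 * η ^ 2) * (48 * exp (2 * K))) - ∑ i ∈ range (k - L),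
      exp (l ^ 2 * v / 2) * exp (-(l ^ 2 / 4 * (v - Δ (x i) (x (k + 1)))))) := by
        rw [← sub_nonneg, ← Finset.sum_sub_distrib]
        have : ∀ k ∈ range N, ((exp (l ^ 2 * v / 2) * ((1 - η / 2) * (l * (m (k + 1) - m k - l * κ k)) -
      l ^ 4 / (2 * η ^ 2) * (48 * exp (2 * K))) - ∑ i ∈ range (k - L),
      exp (l ^ 2 * v / 2) * exp (-(l ^ 2 / 4 * (v - Δ (x i) (x (k + 1)))))) -
      (exp (l ^ 2 * v / 2) * ((1 - η / 2) * (l * ((l * v - l * v) / N - l * κ k)) -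
      l ^ 4 / (2 * η ^ 2) * (48 * exp (2 * K))) - ∑ i ∈ range (k - L),
      exp (l ^ 2 * v / 2) * exp (-(l ^ 2 / 4 * (v - Δ (x i) (x (k + 1))))))) =
      (exp (l ^ 2 * v / 2) * (1 - η / 2) * l) * (m (k + 1) - m k) := fun k _ => by
          rw [sub_self (l * v), zero_div]; ring
        rw [Finset.sum_congr rfl this, ← Finset.mul_sum, Finset.sum_range_sub]
        have hη' : 0 ≤ 1 - η / 2 := by linarith
        have : 0 ≤ m N - m 0 := by linarith
        positivity
    _ ≤ ∑ k ∈ range N, (∫ h : I → ℝ, exp (l * h (x (k + 1))) * f (Me k h - Mw k h) ∂μ -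
        ∫ h : I → ℝ, ∑ i ∈ range (k - L), exp (l / 2 * h (x i) + l / 2 * h (x (k + 1))) ∂μ) := by
        refine Finset.sum_le_sum fun k hk => sub_le_sub (hval k (by simpa using hk)) (le_of_eq ?_)
        rw [integral_finsetSum _ fun i _ => (hfar i k).1]
        exact Finset.sum_congr rfl fun i _ => (hfar i k).2
    _ = ∫ h : I → ℝ, ∑ k ∈ range N, (exp (l * h (x (k + 1))) * f (Me k h - Mw k h) -
        ∑ i ∈ range (k - L), exp (l / 2 * h (x i) + l / 2 * h (x (k + 1)))) ∂μ := by
        rw [integral_finsetSum _ hbr]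
        refine Finset.sum_congr rfl fun k hk => ?_
        rw [integral_sub (hTi k (by simpa using hk)) (hfarI k)]
    _ ≤ _ := by
        refine integral_mono (integrable_finsetSum _ hbr) (hG.integrable_exp_Mx x N l) fun h => ?_
        refine le_trans (Finset.sum_le_sum fun k hk => ?_) (path_low x l hl h L N)
        refine sub_le_sub_right ?_ _
        gcongr
        have := exp_lower (l * (Me k h - Mw k h)) η (mul_nonneg hl (ho0 k h)) hη
        refine le_trans (le_of_eq ?_) this
        simp only [hf]; ring

end GV

/-- Flip coordinate `c`. -/
def flp {n : ℕ} (z : V n) (c : Fin n) : V n := Function.update z c (!z c)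

lemma flp_same {n : ℕ} (z : V n) (c : Fin n) : flp z c c = !z c := by simp [flp]
lemma flp_ne {n : ℕ} (z : V n) {c i : Fin n} (h : i ≠ c) : flp z c i = z i := by simp [flp, h]

lemma dist_flp_eq {n : ℕ} (a z : V n) (c : Fin n) (h : a c = z c) :
    hammingDist a (flp z c) = hammingDist a z + 1 := by
  unfold hammingDist
  have : ({i | a i ≠ flp z c i} : Finset (Fin n)) = insert c ({i | a i ≠ z i} : Finset (Fin n)) := by
    ext i
    by_cases hi : i = c
    · subst hi; simp [flp_same, h]
    · simp [flp_ne z hi, hi]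
  rw [this, card_insert_of_notMem (by simp [h])]

lemma flp_flp {n : ℕ} (z : V n) (c : Fin n) : flp (flp z c) c = z := by
  ext i
  by_cases hi : i = c
  · subst hi; simp [flp_same]
  · simp [flp_ne _ hi]

lemma dist_flp_ne {n : ℕ} (a z : V n) (c : Fin n) (h : a c ≠ z c) :
    hammingDist a (flp z c) + 1 = hammingDist a z := by
  have := dist_flp_eq a (flp z c) c (by rw [flp_same]; revert h; cases a c <;> cases z c <;> simp)
  rw [flp_flp] at this
  exact this.symm

lemma dist_self_flp {n : ℕ} (z : V n) (c : Fin n) : hammingDist z (flp z c) = 1 := by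
  rw [dist_flp_eq z z c rfl]; simp

lemma sum_nbr {n : ℕ} (z : V n) (f : V n → ℝ) :
    ∑ y, (if hammingDist z y = 1 then f y else 0) = ∑ c, f (flp z c) := by
  classical
  rw [← Finset.sum_filter]
  symm
  refine Finset.sum_bij (fun c _ => flp z c) ?_ ?_ ?_ ?_
  · intro c _; simp [dist_self_flp]
  · intro c _ d _ h
    by_contra hcd
    have := congrFun h c
    simp only [flp_same, flp_ne z hcd] at this
    revert this; cases z c <;> simp
  · intro y hy
    simp only [mem_filter, mem_univ, true_and] at hy
    unfold hammingDist at hy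
    obtain ⟨c, hc⟩ := Finset.card_eq_one.1 hy
    refine ⟨c, mem_univ _, ?_⟩
    ext i
    have hi : i ∈ ({i | z i ≠ y i} : Finset (Fin n)) ↔ i = c := by rw [hc]; simp
    simp only [mem_filter, mem_univ, true_and] at hi
    by_cases h : i = c
    · subst h
      have := hi.2 rfl
      rw [flp_same]; revert this; cases z i <;> cases y i <;> simp
    · rw [flp_ne z h]
      by_contra h2
      exact h (hi.1 h2)
  · intro c _; rfl

/-- Expectation for simple random walk run for `m` steps from the uniform law. -/
noncomputable def Ek (n : ℕ) : ℕ → ((ℕ → V n) → ℝ) → ℝ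
  | 0, F => ((2 : ℝ) ^ n)⁻¹ * ∑ x : V n, F (fun _ => x)
  | m + 1, F => Ek n m (fun y => (n : ℝ)⁻¹ * ∑ c, F (fun i => if i ≤ m then y i else flp (y m) c))

lemma Ek_mono {n : ℕ} : ∀ (m : ℕ) (F G : (ℕ → V n) → ℝ),
    (∀ y : ℕ → V n, (∀ k < m, hammingDist (y k) (y (k + 1)) = 1) → F y ≤ G y) →
    Ek n m F ≤ Ek n m G
  | 0, F, G, h => by
    unfold Ek
    gcongr with x
    exact h _ (by simp)
  | m + 1, F, G, h => by
    unfold Ek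
    refine Ek_mono m _ _ fun y hy => ?_
    gcongr with c
    refine h _ fun k hk => ?_
    rcases Nat.lt_succ_iff_lt_or_eq.1 hk with hk | rfl
    · have h1 : k ≤ m := hk.le
      have h2 : k + 1 ≤ m := hk
      simp only [h1, h2, if_true]; exact hy k hk
    · simp [dist_self_flp]

lemma Ek_add {n : ℕ} : ∀ (m : ℕ) (F G : (ℕ → V n) → ℝ),
    Ek n m (fun y => F y + G y) = Ek n m F + Ek n m G
  | 0, F, G => by unfold Ek; rw [Finset.sum_add_distrib, mul_add]
  | m + 1, F, G => by
    unfold Ek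
    rw [← Ek_add m]
    congr 1; funext y
    rw [Finset.sum_add_distrib, mul_add]

lemma Ek_mul {n : ℕ} (a : ℝ) : ∀ (m : ℕ) (F : (ℕ → V n) → ℝ),
    Ek n m (fun y => a * F y) = a * Ek n m F
  | 0, F => by unfold Ek; rw [← Finset.mul_sum]; ring
  | m + 1, F => by
    unfold Ek
    rw [← Ek_mul a m]
    congr 1; funext y
    rw [← Finset.mul_sum]; ring

lemma Ek_const {n : ℕ} (hn : n ≠ 0) (a : ℝ) : ∀ (m : ℕ), Ek n m (fun _ => a) = a
  | 0 => by unfold Ek; simp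
  | m + 1 => by
    unfold Ek
    have hn' : (n : ℝ) ≠ 0 := by exact_mod_cast hn
    simp [hn', Ek_const hn a m]

lemma Ek_sum {n : ℕ} {ι : Type} (m : ℕ) (s : Finset ι) (F : ι → (ℕ → V n) → ℝ) :
    Ek n m (fun y => ∑ i ∈ s, F i y) = ∑ i ∈ s, Ek n m (F i) := by
  classical
  induction s using Finset.induction_on with
  | empty => 
    have := Ek_mul (n := n) 0 m (fun _ => 0)
    simpa using this
  | insert a s ha ih =>
    simp_rw [Finset.sum_insert ha]
    rw [Ek_add, ih]

lemma Ek_marg {n : ℕ} (hn : n ≠ 0) (k : ℕ) (F : (ℕ → V n) → ℝ)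
    (hF : ∀ y y', (∀ i ≤ k, y i = y' i) → F y = F y') (j : ℕ) : Ek n (k + j) F = Ek n k F := by
  induction j with
  | zero => rfl
  | succ j ih =>
    rw [← ih, ← add_assoc]
    conv_lhs => unfold Ek
    congr 1; funext y
    have hn' : (n : ℝ) ≠ 0 := by exact_mod_cast hn
    have : ∀ c, F (fun i => if i ≤ k + j then y i else flp (y (k + j)) c) = F y := fun c =>
      hF _ _ fun i hi => by simp [show i ≤ k + j by omega]
    simp [this, hn']

/-- Path weights. -/
noncomputable def wt (n m : ℕ) (xs : Fin (m + 1) → V n) : ℝ :=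
  ((2 : ℝ) ^ n)⁻¹ *
        ∏ k : Fin m, (if hammingDist (xs k.castSucc) (xs k.succ) = 1 then (n : ℝ)⁻¹ else 0)

/-- Extend a finite path by a constant. -/
def extp {n : ℕ} (m : ℕ) (xs : Fin (m + 1) → V n) (i : ℕ) : V n :=
  xs ⟨min i m, by omega⟩

lemma sum_wt {n : ℕ} : ∀ (m : ℕ) (F : (ℕ → V n) → ℝ),
    ∑ xs, wt n m xs * F (extp m xs) = Ek n m F
  | 0, F => by
    unfold Ek wt
    rw [Finset.mul_sum]
    refine Fintype.sum_equiv (Equiv.funUnique (Fin 1) (V n)) _ _ fun xs => ?_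
    simp only [univ_eq_empty, prod_empty, mul_one]
    congr 2
    funext i
    simp [extp, Equiv.funUnique]
  | m + 1, F => by
    have hs := sum_wt m (fun y => (n : ℝ)⁻¹ * ∑ c, F (fun i => if i ≤ m then y i else flp (y m) c))
    unfold Ek
    rw [← hs]
    rw [← Fintype.sum_equiv (Fin.snocEquiv (fun _ : Fin (m + 2) => V n)) 
      (fun q => wt n (m + 1) (Fin.snocEquiv (fun _ : Fin (m + 2) => V n) q) *
        F (extp (m + 1) (Fin.snocEquiv (fun _ : Fin (m + 2) => V n) q))) _ (fun q => rfl),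
      Fintype.sum_prod_type_right]
    refine Finset.sum_congr rfl fun ys _ => ?_
    have hext : extp m ys m = ys (Fin.last m) := by
      unfold extp; congr 1; ext; simp
    rw [← mul_assoc, hext, ← sum_nbr (ys (Fin.last m))
      (fun z => F (fun i => if i ≤ m then extp m ys i else z)), Finset.mul_sum]
    refine Finset.sum_congr rfl fun z _ => ?_
    have h1 : wt n (m + 1) (Fin.snocEquiv (fun _ : Fin (m + 2) => V n) (z, ys)) =
        wt n m ys * (if hammingDist (ys (Fin.last m)) z = 1 then (n : ℝ)⁻¹ else 0) := by
      unfold wt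
      rw [Fin.prod_univ_castSucc, ← mul_assoc]
      congr 1
      · congr 1
        refine Finset.prod_congr rfl fun k _ => ?_
        simp [Fin.snocEquiv, -Fin.castSucc_succ, Fin.succ_castSucc]
      · simp [Fin.snocEquiv]
    have h2 : extp (m + 1) (Fin.snocEquiv (fun _ : Fin (m + 2) => V n) (z, ys)) =
        fun i => if i ≤ m then extp m ys i else z := by
      funext i
      unfold extp
      by_cases hi : i ≤ m
      · rw [if_pos hi]
        have : (⟨min i (m + 1), by omega⟩ : Fin (m + 2)) = Fin.castSucc ⟨min i m, by omega⟩ := by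
          ext; simp; omega
        rw [this]
        exact Fin.snoc_castSucc (α := fun _ => V n) z ys ⟨min i m, by omega⟩
      · rw [if_neg hi]
        have : (⟨min i (m + 1), by omega⟩ : Fin (m + 2)) = Fin.last (m + 1) := by
          ext; simp; omega
        rw [this]; simp [Fin.snocEquiv]
    rw [h1, h2]
    split_ifs <;> ring

/-- Covariance of the p-spin model. -/
noncomputable def Dl (n p : ℕ) (x y : V n) : ℝ := (n : ℝ) * overlap n x y ^ p

lemma hd_le {n : ℕ} (x y : V n) : (hammingDist x y : ℝ) ≤ n := by
  have := hammingDist_le_card_fintype (x := x) (y := y)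
  simp at this
  exact_mod_cast this

lemma abs_overlap_le {n : ℕ} (hn : n ≠ 0) (x y : V n) : |overlap n x y| ≤ 1 := by
  have hn' : (0 : ℝ) < n := by positivity
  have h1 := hd_le x y
  have h2 : 2 * (hammingDist x y : ℝ) / n ≤ 2 := by rw [div_le_iff₀ hn']; linarith
  have h3 : 0 ≤ 2 * (hammingDist x y : ℝ) / n := by positivity
  unfold overlap
  rw [abs_le]; constructor <;> linarith

lemma overlap_symm {n : ℕ} (x y : V n) : overlap n x y = overlap n y x := by
  unfold overlap; rw [hammingDist_comm]

lemma Dl_self {n p : ℕ} (x : V n) : Dl n p x x = n := by simp [Dl, overlap]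

lemma abs_Dl_le {n p : ℕ} (hn : n ≠ 0) (x y : V n) : |Dl n p x y| ≤ n := by
  unfold Dl
  rw [abs_mul, abs_pow, abs_of_nonneg (by positivity : (0 : ℝ) ≤ n)]
  have := pow_le_one₀ (abs_nonneg _) (abs_overlap_le hn x y) (n := p)
  have hn' : (0 : ℝ) ≤ n := by positivity
  nlinarith

lemma overlap_nbr {n : ℕ} (x y y' : V n) (h : hammingDist y y' = 1) :
    |overlap n x y - overlap n x y'| ≤ 2 / n := by
  have h1 := hammingDist_triangle x y y'
  have h2 := hammingDist_triangle x y' y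
  rw [hammingDist_comm y' y] at h2
  rw [h] at h1 h2
  have h1' : (hammingDist x y' : ℝ) ≤ hammingDist x y + 1 := by exact_mod_cast h1
  have h2' : (hammingDist x y : ℝ) ≤ hammingDist x y' + 1 := by exact_mod_cast h2
  unfold overlap
  have e : (1 - 2 * (hammingDist x y : ℝ) / n) - (1 - 2 * (hammingDist x y' : ℝ) / n) =
    2 / n * (hammingDist x y' - hammingDist x y) := by ring
  rw [e, abs_mul, abs_of_nonneg (by positivity : (0 : ℝ) ≤ 2 / n)]
  have : |(hammingDist x y' : ℝ) - hammingDist x y| ≤ 1 := by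
    rw [abs_le]; constructor <;> linarith
  have h3 : (0 : ℝ) ≤ 2 / n := by positivity
  nlinarith

lemma Dl_nbr {n p : ℕ} (hn : n ≠ 0) (x y y' : V n) (h : hammingDist y y' = 1) :
    |Dl n p x y - Dl n p x y'| ≤ 2 * p := by
  have hn' : (0 : ℝ) < n := by positivity
  unfold Dl
  rw [← mul_sub, abs_mul, abs_of_pos hn']
  have h1 := abs_pow_sub_pow_le (overlap n x y) (overlap n x y') p
  have h2 : max |overlap n x y| |overlap n x y'| ^ (p - 1) ≤ 1 :=
    pow_le_one₀ (le_max_of_le_left (abs_nonneg _))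
      (max_le (abs_overlap_le hn x y) (abs_overlap_le hn x y'))
  have h3 := overlap_nbr x y y' h
  have h4 : |overlap n x y ^ p - overlap n x y' ^ p| ≤ 2 / n * p := by
    refine h1.trans ?_
    calc _ ≤ 2 / (n : ℝ) * p * 1 := by gcongr
      _ = _ := by ring
  calc _ ≤ (n : ℝ) * (2 / n * p) := by gcongr
    _ = _ := by field_simp

lemma pow_dec (a b : ℝ) (p : ℕ) (hb : 0 ≤ b) (hab : b ≤ a) :
    (p : ℝ) * b ^ (p - 1) * (a - b) ≤ a ^ p - b ^ p := by
  induction p with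
  | zero => simp
  | succ k ih =>
    rcases Nat.eq_zero_or_pos k with rfl | hk
    · simp
    · have e1 : b ^ k = b ^ (k - 1) * b := by rw [← pow_succ]; congr 1; omega
      have h1 : b ^ k ≤ a ^ k := by gcongr
      have h2 : (0 : ℝ) ≤ b ^ (k - 1) := by positivity
      simp only [Nat.add_sub_cancel]
      push_cast
      rw [pow_succ, pow_succ]
      have h3 : (a ^ k - k * b ^ (k - 1) * (a - b) - b ^ k) * b ≥ 0 := by
        apply mul_nonneg _ hb; linarith
      have h4 : (a ^ k - b ^ k) * (a - b) ≥ 0 := mul_nonneg (by linarith) (by linarith)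
      rw [e1] at *
      nlinarith

lemma Dl_good {n p L : ℕ} (hn : n ≠ 0) (a z z' : V n)
    (hd : hammingDist a z' = hammingDist a z + 1) (hL : hammingDist a z ≤ L)
    (hρ : 0 ≤ 1 - 2 * ((L : ℝ) + 1) / n) :
    Dl n p a z' - Dl n p a z ≤ -(2 * p * (1 - 2 * ((L : ℝ) + 1) / n) ^ (p - 1)) := by
  have hn' : (0 : ℝ) < n := by positivity
  have h1 : overlap n a z' = overlap n a z - 2 / n := by
    unfold overlap; rw [hd]; push_cast; ring
  have hL' : (hammingDist a z : ℝ) ≤ L := by exact_mod_cast hL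
  have h2 : 1 - 2 * ((L : ℝ) + 1) / n ≤ overlap n a z' := by
    unfold overlap; rw [hd]; push_cast; gcongr
  have h3 := pow_dec (overlap n a z) (overlap n a z') p (hρ.trans h2) (by
    rw [h1]; have : (0 : ℝ) ≤ 2 / n := by positivity
    linarith)
  have h4 : overlap n a z - overlap n a z' = 2 / n := by rw [h1]; ring
  rw [h4] at h3
  have h5 : (1 - 2 * ((L : ℝ) + 1) / n) ^ (p - 1) ≤ overlap n a z' ^ (p - 1) := by gcongr
  unfold Dl
  have h6 : (n : ℝ) * (p * overlap n a z' ^ (p - 1) * (2 / n)) ≤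
    n * (overlap n a z ^ p - overlap n a z' ^ p) := by gcongr
  have h7 : (n : ℝ) * (p * overlap n a z' ^ (p - 1) * (2 / n)) = 2 * p * overlap n a z' ^ (p - 1) := by
    field_simp
  have h8 : 2 * (p : ℝ) * (1 - 2 * ((L : ℝ) + 1) / n) ^ (p - 1) ≤ 2 * p * overlap n a z' ^ (p - 1) := by
    gcongr
  nlinarith

/-- Antipode. -/
def anti {n : ℕ} (x : V n) : V n := fun i => !x i

lemma dist_anti {n : ℕ} (x y : V n) : hammingDist (anti x) y + hammingDist x y = n := by
  unfold hammingDist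
  have : ({i | anti x i ≠ y i} : Finset (Fin n)) = ({i | ¬ (x i ≠ y i)} : Finset (Fin n)) := by
    have key : ∀ b b' : Bool, (!b) ≠ b' ↔ ¬ (b ≠ b') := by decide
    ext i
    rw [mem_filter, mem_filter]
    exact and_congr_right fun _ => key (x i) (y i)
  rw [this, add_comm]
  have h := Finset.card_filter_add_card_filter_not (s := (univ : Finset (Fin n))) (fun i => x i ≠ y i)
  simpa using h

lemma far_bd {n p : ℕ} (hn : n ≠ 0) (hp : 2 ≤ p) (l : ℝ) (x y : V n) :
    exp (-(l ^ 2 / 4 * (n - Dl n p x y))) ≤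
      exp (-(l ^ 2 / 2 * hammingDist x y)) + exp (-(l ^ 2 / 2 * hammingDist (anti x) y)) := by
  have hn' : (0 : ℝ) < n := by positivity
  have ha : (hammingDist (anti x) y : ℝ) = n - hammingDist x y := by
    have := dist_anti x y
    have h : (hammingDist (anti x) y : ℝ) + hammingDist x y = n := by exact_mod_cast this
    linarith
  rw [ha]
  set d : ℝ := ((hammingDist x y : ℕ) : ℝ) with hd
  have hd0 : 0 ≤ d := by positivity
  have hdn : d ≤ n := hd_le x y
  have h1 : overlap n x y ^ p ≤ overlap n x y ^ 2 := by
    calc _ ≤ |overlap n x y ^ p| := le_abs_self _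
      _ = |overlap n x y| ^ p := abs_pow _ _
      _ ≤ |overlap n x y| ^ 2 := pow_le_pow_of_le_one (abs_nonneg _) (abs_overlap_le hn x y) hp
      _ = _ := sq_abs _
  have h2 : 4 * d * (1 - d / n) ≤ n - Dl n p x y := by
    have : n - (n : ℝ) * overlap n x y ^ 2 = 4 * d * (1 - d / n) := by
      unfold overlap; rw [← hd]; field_simp; ring
    unfold Dl; nlinarith
  have hl : 0 ≤ l ^ 2 := sq_nonneg l
  have h5 : 4 * d * (1 - d / n) * n = 4 * d * (n - d) := by field_simp
  have p1 := exp_pos (-(l ^ 2 / 2 * d))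
  have p2 := exp_pos (-(l ^ 2 / 2 * (n - d)))
  rcases le_total d (n / 2) with h | h
  · have h3 : 2 * d ≤ 4 * d * (1 - d / n) := by
      have : 2 * d * n ≤ 4 * d * (1 - d / n) * n := by rw [h5]; nlinarith
      exact le_of_mul_le_mul_right this hn'
    have : exp (-(l ^ 2 / 4 * (n - Dl n p x y))) ≤ exp (-(l ^ 2 / 2 * d)) := by
      apply exp_le_exp.2; nlinarith
    linarith
  · have h3 : 2 * (n - d) ≤ 4 * d * (1 - d / n) := by
      have : 2 * (n - d) * n ≤ 4 * d * (1 - d / n) * n := by rw [h5]; nlinarith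
      exact le_of_mul_le_mul_right this hn'
    have : exp (-(l ^ 2 / 4 * (n - Dl n p x y))) ≤ exp (-(l ^ 2 / 2 * (n - d))) := by
      apply exp_le_exp.2; nlinarith
    linarith

lemma one_step {n : ℕ} (hn : n ≠ 0) (s : ℝ) (hs : 0 ≤ s) (hs1 : s ≤ 2 / 5) (a z : V n) :
    (n : ℝ)⁻¹ * ∑ c, exp (-(s * hammingDist a (flp z c))) ≤
      exp (-(s / 4)) * exp (-(s * hammingDist a z)) + exp (s - s * n / 4) := by
  have hn' : (0 : ℝ) < n := by positivity
  set d : ℝ := ((hammingDist a z : ℕ) : ℝ) with hd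
  have hval : ∀ c, exp (-(s * hammingDist a (flp z c))) =
      if a c ≠ z c then exp (-(s * d)) * exp s else exp (-(s * d)) * exp (-s) := fun c => by
    split_ifs with h
    · have := dist_flp_ne a z c h
      have h' : (hammingDist a (flp z c) : ℝ) = d - 1 := by
        rw [hd, ← this]; push_cast; ring
      rw [h', ← exp_add]; congr 1; ring
    · push Not at h
      rw [dist_flp_eq a z c h, ← exp_add]; congr 1; push_cast; ring
  rcases le_total d (n / 4) with h | h
  · have hsum : ∑ c, exp (-(s * hammingDist a (flp z c))) =
        exp (-(s * d)) * (d * exp s + (n - d) * exp (-s)) := by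
      simp_rw [hval]
      rw [Finset.sum_ite, Finset.sum_const, Finset.sum_const]
      have h1 : (#{c | a c ≠ z c} : ℝ) = d := rfl
      have h2 : (#{c | ¬ (a c ≠ z c)} : ℝ) = n - d := by
        have h := Finset.card_filter_add_card_filter_not (s := (univ : Finset (Fin n)))
          (fun i => a i ≠ z i)
        simp only [card_univ, Fintype.card_fin] at h
        have h' : (#{c | a c ≠ z c} : ℝ) + (#{c | ¬ (a c ≠ z c)} : ℝ) = n := by exact_mod_cast h
        linarith
      rw [nsmul_eq_mul, nsmul_eq_mul, h1, h2]; ring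
    rw [hsum]
    have e1 : exp (-s) ≤ 1 - s + s ^ 2 / 2 := by
      have h2 := Real.quadratic_le_exp_of_nonneg hs
      have h3 : exp (-s) * exp s = 1 := by rw [← exp_add]; simp
      have h5 := exp_pos (-s)
      have h4 : exp (-s) * (1 + s + s ^ 2 / 2) ≤ 1 := by nlinarith
      have h6 : 1 ≤ (1 - s + s ^ 2 / 2) * (1 + s + s ^ 2 / 2) := by nlinarith [sq_nonneg (s ^ 2)]
      have h7 : 0 < 1 + s + s ^ 2 / 2 := by positivity
      exact le_of_mul_le_mul_right (h4.trans h6) h7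
    have e2 : exp s ≤ 1 + s + s ^ 2 := by
      have := Real.abs_exp_sub_one_sub_id_le (x := s) (by rw [abs_of_nonneg hs]; linarith)
      have := (abs_le.1 this).2
      linarith
    have e3 := add_one_le_exp (-(s / 4))
    have e4 : exp (-s) ≤ exp s := exp_le_exp.2 (by linarith)
    have key : (n : ℝ)⁻¹ * (d * exp s + (n - d) * exp (-s)) ≤ exp (-(s / 4)) := by
      rw [inv_mul_le_iff₀ hn']
      have : d * exp s + (n - d) * exp (-s) ≤ n / 4 * exp s + (n - n / 4) * exp (-s) := by nlinarith
      have h8 : (1 / 4) * exp s + (3 / 4) * exp (-s) ≤ exp (-(s / 4)) := by nlinarith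
      nlinarith
    have p1 := exp_pos (-(s * d))
    have p2 := exp_pos (s - s * n / 4)
    have : (n : ℝ)⁻¹ * (exp (-(s * d)) * (d * exp s + (n - d) * exp (-s))) =
      ((n : ℝ)⁻¹ * (d * exp s + (n - d) * exp (-s))) * exp (-(s * d)) := by ring
    rw [this]
    have := mul_le_mul_of_nonneg_right key p1.le
    linarith
  · have hb : ∀ c, exp (-(s * hammingDist a (flp z c))) ≤ exp (s - s * n / 4) := fun c => by
      rw [hval]
      have : exp (-(s * d)) * exp s ≤ exp (s - s * n / 4) := by
        rw [← exp_add]; apply exp_le_exp.2; nlinarith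
      split_ifs
      · exact this
      · refine le_trans ?_ this
        gcongr; linarith
    have : (n : ℝ)⁻¹ * ∑ c, exp (-(s * hammingDist a (flp z c))) ≤ exp (s - s * n / 4) := by
      rw [inv_mul_le_iff₀ hn']
      refine (Finset.sum_le_sum fun c _ => hb c).trans ?_
      simp
    have : 0 < exp (-(s / 4)) * exp (-(s * d)) := by positivity
    linarith

lemma Ek_dist {n : ℕ} (hn : n ≠ 0) (s : ℝ) (hs : 0 ≤ s) (hs1 : s ≤ 2 / 5) (A : V n → V n)
    (i j : ℕ) : Ek n (i + j) (fun y => exp (-(s * hammingDist (A (y i)) (y (i + j))))) ≤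
      exp (-(s / 4)) ^ j + j * exp (s - s * n / 4) := by
  induction j with
  | zero =>
    have : Ek n (i + 0) (fun y => exp (-(s * hammingDist (A (y i)) (y (i + 0))))) ≤
        Ek n (i + 0) (fun _ => 1) := Ek_mono _ _ _ fun y _ => by
      apply exp_le_one_iff.2
      have : 0 ≤ s * hammingDist (A (y i)) (y (i + 0)) := by positivity
      linarith
    rw [Ek_const hn] at this
    simpa using this
  | succ j ih =>
    rw [← add_assoc]
    unfold Ek
    have : ∀ y : ℕ → V n, ((n : ℝ)⁻¹ * ∑ c, exp (-(s * hammingDist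
        (A (if i ≤ i + j then y i else flp (y (i + j)) c))
        (if i + j + 1 ≤ i + j then y (i + j + 1) else flp (y (i + j)) c)))) ≤
        exp (-(s / 4)) * exp (-(s * hammingDist (A (y i)) (y (i + j)))) + exp (s - s * n / 4) :=
      fun y => by
        have := one_step hn s hs hs1 (A (y i)) (y (i + j))
        simpa using this
    refine (Ek_mono _ _ _ fun y _ => this y).trans ?_
    rw [Ek_add, Ek_mul, Ek_const hn, pow_succ]
    have hq : exp (-(s / 4)) ≤ 1 := by apply exp_le_one_iff.2; linarith
    have hq0 := exp_pos (-(s / 4))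
    have he := exp_pos (s - s * n / 4)
    push_cast
    have hj : (0 : ℝ) ≤ j := by positivity
    have := mul_le_mul_of_nonneg_left ih hq0.le
    have h9 : exp (-(s / 4)) * (j * exp (s - s * n / 4)) ≤ j * exp (s - s * n / 4) := by
      have : 0 ≤ j * exp (s - s * n / 4) := by positivity
      nlinarith
    nlinarith

open Classical in
/-- Indicator that the step at time `k` fails to increase some distance within the window. -/
noncomputable def bd {n : ℕ} (L k : ℕ) (y : ℕ → V n) : ℝ :=
  if ∃ i ∈ Icc (k - L) k, hammingDist (y (i + 1)) (y (k + 2)) ≠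
    hammingDist (y (i + 1)) (y (k + 1)) + 1 then 1 else 0

lemma path_dist {n : ℕ} (m : ℕ) (y : ℕ → V n)
    (hy : ∀ k < m, hammingDist (y k) (y (k + 1)) = 1) (i j : ℕ) (h : i + j ≤ m) :
    hammingDist (y i) (y (i + j)) ≤ j := by
  induction j with
  | zero => simp
  | succ j ih =>
    have h1 := ih (by omega)
    have h2 := hammingDist_triangle (y i) (y (i + j)) (y (i + (j + 1)))
    have h3 := hy (i + j) (by omega)
    rw [← add_assoc] at *
    omega

lemma path_coord {n : ℕ} (y : ℕ → V n) (c : Fin n) (k : ℕ) : ∀ j i, i + j = k →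
    (∀ a ∈ Ico i k, y (a + 1) c = y (a + 2) c) → y (i + 1) c = y (k + 1) c
  | 0, i, h, _ => by simp at h; rw [h]
  | j + 1, i, h, H => by
    rw [H i (by simp; omega)]
    exact path_coord y c k j (i + 1) (by omega) fun a ha => H a (by simp at ha ⊢; omega)

lemma bad_prob {n : ℕ} (hn : n ≠ 0) (L k m : ℕ) (hm : k + 2 ≤ m) :
    Ek n m (bd L k) ≤ (L : ℝ) / n := by
  classical
  have hn' : (0 : ℝ) < n := by positivity
  obtain ⟨j, rfl⟩ := Nat.exists_eq_add_of_le hm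
  rw [Ek_marg hn (k + 2) (bd L k) (fun y y' h => by
    unfold bd
    have : (∃ i ∈ Icc (k - L) k, hammingDist (y (i + 1)) (y (k + 2)) ≠
        hammingDist (y (i + 1)) (y (k + 1)) + 1) ↔ (∃ i ∈ Icc (k - L) k,
        hammingDist (y' (i + 1)) (y' (k + 2)) ≠ hammingDist (y' (i + 1)) (y' (k + 1)) + 1) := by
      refine exists_congr fun i => and_congr_right fun hi => ?_
      simp at hi
      rw [h (i + 1) (by omega), h (k + 2) le_rfl, h (k + 1) (by omega)]
    simp only [this])]
  have : Ek n (k + 2) (bd L k) = Ek n (k + 1) (fun y => (n : ℝ)⁻¹ * ∑ c,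
    bd L k (fun i => if i ≤ k + 1 then y i else flp (y (k + 1)) c)) := rfl
  rw [this]
  rw [← Ek_const hn ((L : ℝ) / n) (k + 1)]
  refine Ek_mono _ _ _ fun y hy => ?_
  rw [inv_mul_le_iff₀ hn', mul_div_cancel₀ _ hn'.ne']
  have hb : ∀ c, bd L k (fun i => if i ≤ k + 1 then y i else flp (y (k + 1)) c) ≤
      ∑ a ∈ Ico (k - L) k, (if y (a + 1) c ≠ y (a + 2) c then (1 : ℝ) else 0) := fun c => by
    have hnn : ∀ a ∈ Ico (k - L) k, (0 : ℝ) ≤ (if y (a + 1) c ≠ y (a + 2) c then (1 : ℝ) else 0) :=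
      fun a _ => by split_ifs <;> norm_num
    unfold bd
    split_ifs with h
    · obtain ⟨i, hi, h⟩ := h
      simp at hi
      have e1 : (i + 1 ≤ k + 1) := by omega
      have e2 : ¬ (k + 2 ≤ k + 1) := by omega
      simp only [e1, e2, le_refl, if_true, if_false] at h
      have h3 : y (i + 1) c ≠ y (k + 1) c := fun h4 => h (dist_flp_eq _ _ _ h4)
      have h5 : ∃ a ∈ Ico i k, y (a + 1) c ≠ y (a + 2) c := by
        by_contra hcon
        push Not at hcon
        exact h3 (path_coord y c k (k - i) i (by omega) hcon)
      obtain ⟨a, ha, h6⟩ := h5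
      have := Finset.single_le_sum hnn (a := a) (by simp at ha ⊢; omega)
      simpa [h6] using this
    · exact Finset.sum_nonneg hnn
  refine (Finset.sum_le_sum fun c _ => hb c).trans ?_
  rw [Finset.sum_comm]
  have hs : ∀ a ∈ Ico (k - L) k, ∑ c, (if y (a + 1) c ≠ y (a + 2) c then (1 : ℝ) else 0) = 1 :=
    fun a ha => by
      have := hy (a + 1) (by simp at ha; omega)
      rw [Finset.sum_boole]
      unfold hammingDist at this
      exact_mod_cast this
  rw [Finset.sum_congr rfl hs]
  simp
  exact_mod_cast (by omega : k ≤ L + (k - L))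

section avg
variable {n p : ℕ} {μ : Measure (V n → ℝ)}

lemma low_avg (hn : n ≠ 0) (hp : 2 ≤ p) (hG : GV μ (Dl n p) n) (N L : ℕ) (l η : ℝ)
    (hl : 0 ≤ l) (hl1 : l ≤ 1 / 2) (hη : 0 < η) (hη2 : η ≤ 2)
    (hρ : 0 ≤ 1 - 2 * ((L : ℝ) + 1) / n) :
    exp (l ^ 2 * n / 2) * ((1 - η / 2) * l ^ 2 *
        (N * (2 * p * (1 - 2 * ((L : ℝ) + 1) / n) ^ (p - 1) - 4 * p * (L / n))) -
        N * (l ^ 4 / (2 * η ^ 2) * (48 * exp (2 * (2 * p)))) -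
        N * (N * (2 * (exp (-(l ^ 2 / 2 / 4)) ^ L + (N + 1) * exp (l ^ 2 / 2 - l ^ 2 / 2 * n / 4)))))
      ≤ Ek n (N + 1) (fun y => ∫ h, exp (l * Mx (fun i => y (i + 1)) N h) ∂μ) := by
  have hn' : (0 : ℝ) < n := by positivity
  set ζ : ℝ := (1 - 2 * ((L : ℝ) + 1) / n) ^ (p - 1) with hζ
  have hζ1 : ζ ≤ 1 := pow_le_one₀ hρ (by
    have : 0 ≤ 2 * ((L : ℝ) + 1) / n := by positivity
    linarith)
  set E := exp (l ^ 2 * n / 2) with hE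
  have hE0 : 0 ≤ E := exp_nonneg _
  set C := l ^ 4 / (2 * η ^ 2) * (48 * exp (2 * (2 * p))) with hC
  set far : ℕ → ℕ → (ℕ → V n) → ℝ := fun i k y =>
    exp (-(l ^ 2 / 2 * hammingDist (y (i + 1)) (y (k + 2)))) +
      exp (-(l ^ 2 / 2 * hammingDist (anti (y (i + 1))) (y (k + 2)))) with hfar
  have hη' : 0 ≤ 1 - η / 2 := by linarith
  have hpath : ∀ y : ℕ → V n, (∀ k < N + 1, hammingDist (y k) (y (k + 1)) = 1) →
      (E * ((1 - η / 2) * l ^ 2 * (N * (2 * p * ζ)) - N * C) +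
        (-(E * ((1 - η / 2) * l ^ 2 * (4 * p)))) * ∑ k ∈ range N, bd L k y) +
        (-E) * ∑ k ∈ range N, ∑ i ∈ range (k - L), far i k y ≤
      ∫ h, exp (l * Mx (fun i => y (i + 1)) N h) ∂μ := fun y hy => by
    refine le_trans ?_ (hG.low (fun i => y (i + 1)) N L l (2 * p) η hl (by linarith) hη hη2
      (fun k => -(2 * p * ζ) + 4 * p * bd L k y) ?_ ?_)
    · have e : ∑ k ∈ range N, (-(2 * (p : ℝ) * ζ) + 4 * p * bd L k y) =
          - (N * (2 * p * ζ)) + 4 * p * ∑ k ∈ range N, bd L k y := by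
        rw [Finset.sum_add_distrib, ← Finset.mul_sum]; simp
      have hf : ∑ k ∈ range N, ∑ i ∈ range (k - L),
          exp (-(l ^ 2 / 4 * (n - Dl n p (y (i + 1)) (y (k + 1 + 1))))) ≤
          ∑ k ∈ range N, ∑ i ∈ range (k - L), far i k y :=
        Finset.sum_le_sum fun k _ => Finset.sum_le_sum fun i _ => far_bd hn hp l _ _
      rw [e]
      have := mul_le_mul_of_nonneg_left hf hE0
      nlinarith
    · intro k hk
      have := Dl_nbr (p := p) hn (y (k + 1)) (y (k + 1)) (y (k + 1 + 1)) (hy (k + 1) (by omega))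
      rw [Dl_self] at this
      exact (abs_le.1 this).2
    · intro k hk i hi
      simp at hi
      by_cases hb : ∃ i ∈ Icc (k - L) k, hammingDist (y (i + 1)) (y (k + 2)) ≠
          hammingDist (y (i + 1)) (y (k + 1)) + 1
      · have h1 : bd L k y = 1 := by unfold bd; rw [if_pos hb]
        have h2 := Dl_nbr (p := p) hn (y (i + 1)) (y (k + 1)) (y (k + 1 + 1)) (hy (k + 1) (by omega))
        have h3 := (abs_le.1 h2).1
        rw [h1]
        have hp0 : (0 : ℝ) ≤ p := by positivity
        nlinarith
      · have h1 : bd L k y = 0 := by unfold bd; rw [if_neg hb]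
        push Not at hb
        have h2 := hb i (by simp; omega)
        have h4 := path_dist (N + 1) y hy (i + 1) (k - i) (by omega)
        rw [show i + 1 + (k - i) = k + 1 by omega] at h4
        have h3 := Dl_good (p := p) hn (y (i + 1)) (y (k + 1)) (y (k + 2)) h2
          (h4.trans (by omega : k - i ≤ L)) hρ
        rw [h1]
        simpa using h3
  refine le_trans ?_ (Ek_mono (N + 1) _ _ hpath)
  rw [Ek_add, Ek_add, Ek_const hn, Ek_mul, Ek_mul, Ek_sum, Ek_sum]
  simp_rw [Ek_sum]
  have hbd : ∑ k ∈ range N, Ek n (N + 1) (bd L k) ≤ N * (L / n) := by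
    refine (Finset.sum_le_sum fun k hk => bad_prob hn L k (N + 1) (by simp at hk; omega)).trans ?_
    simp
  set q := exp (-(l ^ 2 / 2 / 4)) with hq
  set ε := exp (l ^ 2 / 2 - l ^ 2 / 2 * n / 4) with hε
  have hq1 : q ≤ 1 := by apply exp_le_one_iff.2; have := sq_nonneg l; linarith
  have hq0 : 0 ≤ q := exp_nonneg _
  have hε0 : 0 ≤ ε := exp_nonneg _
  have hone : ∀ k ∈ range N, ∀ i ∈ range (k - L), Ek n (N + 1) (far i k) ≤
      2 * (q ^ L + (N + 1) * ε) := fun k hk i hi => by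
    simp at hk hi
    have key : ∀ A : V n → V n, Ek n (N + 1) (fun y =>
        exp (-(l ^ 2 / 2 * hammingDist (A (y (i + 1))) (y (k + 2))))) ≤ q ^ L + (N + 1) * ε := by
      intro A
      obtain ⟨j, hj⟩ := Nat.exists_eq_add_of_le (show k + 2 ≤ N + 1 by omega)
      rw [hj, Ek_marg hn (k + 2) _ (fun y y' h => by
        rw [h (i + 1) (by omega), h (k + 2) le_rfl])]
      have := Ek_dist hn (l ^ 2 / 2) (by positivity) (by nlinarith) A (i + 1) (k + 1 - i)
      rw [show i + 1 + (k + 1 - i) = k + 2 by omega] at this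
      refine this.trans (add_le_add ?_ ?_)
      · exact pow_le_pow_of_le_one hq0 hq1 (by omega)
      · gcongr
        have : ((k + 1 - i : ℕ) : ℝ) ≤ (N + 1 : ℕ) := by exact_mod_cast (by omega)
        exact_mod_cast this
    simp only [hfar]
    rw [Ek_add]
    have h1 := key id
    have h2 := key anti
    simp only [id] at h1
    linarith
  have hfs : ∑ k ∈ range N, ∑ i ∈ range (k - L), Ek n (N + 1) (far i k) ≤
      N * (N * (2 * (q ^ L + (N + 1) * ε))) := by
    have hB : 0 ≤ 2 * (q ^ L + (N + 1) * ε) := by positivity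
    calc _ ≤ ∑ k ∈ range N, (N * (2 * (q ^ L + (N + 1) * ε))) := by
          refine Finset.sum_le_sum fun k hk => (Finset.sum_le_sum (hone k hk)).trans ?_
          rw [Finset.sum_const, card_range, nsmul_eq_mul]
          simp at hk
          gcongr
          omega
      _ = _ := by simp
  have h1 : 0 ≤ E * ((1 - η / 2) * l ^ 2 * (4 * p)) := by positivity
  have h2 := mul_le_mul_of_nonneg_left hbd h1
  have h3 := mul_le_mul_of_nonneg_left hfs hE0
  linarith

lemma up_avg (hn : n ≠ 0) (hG : GV μ (Dl n p) n) (N : ℕ) (l : ℝ) (hl : 0 ≤ l) :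
    Ek n (N + 1) (fun y => ∫ h, exp (l * Mx (fun i => y (i + 1)) N h) ∂μ) ≤
      exp (l ^ 2 * n / 2) * (1 + l * √((N + 1) * n) + N * (2 * p) * l ^ 2) := by
  rw [← Ek_const hn (exp (l ^ 2 * n / 2) * (1 + l * √((N + 1) * n) + N * (2 * p) * l ^ 2)) (N + 1)]
  refine Ek_mono _ _ _ fun y hy => ?_
  exact hG.up (fun i => y (i + 1)) N l (2 * p) hl fun k hk i =>
    Dl_nbr hn i _ _ (hy (k + 1) (by omega))

end avg

/-- Gaussian tail. -/
noncomputable def Tl (m v b : ℝ) : ℝ := (gaussianReal m v.toNNReal).real (Set.Ioi b)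

lemma Tl_nonneg (m v b : ℝ) : 0 ≤ Tl m v b := measureReal_nonneg
lemma Tl_le_one (m v b : ℝ) : Tl m v b ≤ 1 := measureReal_le_one

namespace GV
section
variable {I : Type} [Fintype I] {μ : Measure (I → ℝ)} {Δ : I → I → ℝ} {v : ℝ}

lemma J_eq (hG : GV μ Δ v) (x : ℕ → I) (N : ℕ) (l : ℝ) :
    ∫ h, exp (l * Mx x N h) ∂μ = exp (l ^ 2 * v / 2) *
      (∫⁻ z, Gd μ Δ v x N z ∂gaussianReal (l * v) v.toNNReal).toReal := by
  rw [integral_eq_lintegral_of_nonneg_ae (ae_of_all _ fun _ => exp_nonneg _)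
    (hG.integrable_exp_Mx x N l).aestronglyMeasurable, hG.max_exp, ENNReal.toReal_mul,
    ENNReal.toReal_ofReal (exp_nonneg _)]

lemma Jfin (hG : GV μ Δ v) (x : ℕ → I) (N : ℕ) (m : ℝ) :
    ∫⁻ z, Gd μ Δ v x N z ∂gaussianReal m v.toNNReal ≠ ⊤ := by
  refine ne_top_of_le_ne_top ?_ (lintegral_mono fun z => hG.Gd_le x N z)
  rw [lintegral_const, measure_univ]; simp

lemma Gfin (hG : GV μ Δ v) (x : ℕ → I) (N : ℕ) (z : ℝ) : Gd μ Δ v x N z ≠ ⊤ :=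
  ne_top_of_le_ne_top (ENNReal.natCast_ne_top _) (hG.Gd_le x N z)

/-- tail lower bound through monotone density -/
lemma I1 (hG : GV μ Δ v) (x : ℕ → I) (N : ℕ) (m b : ℝ) :
    (Gd μ Δ v x N b).toReal * Tl m v b ≤
      (∫⁻ z in Set.Ioi b, Gd μ Δ v x N z ∂gaussianReal m v.toNNReal).toReal := by
  unfold Tl Measure.real
  rw [← ENNReal.toReal_mul]
  refine ENNReal.toReal_mono (ne_top_of_le_ne_top (hG.Jfin x N m) (setLIntegral_le_lintegral _ _)) ?_
  rw [← setLIntegral_const]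
  exact setLIntegral_mono (hG.measurable_Gd x N) fun z hz => hG.Gd_mono x N (le_of_lt hz)

lemma I2 (hG : GV μ Δ v) (x : ℕ → I) (N : ℕ) (m b : ℝ) (S : Set ℝ) (hS : MeasurableSet S) :
    (∫⁻ z in S, Gd μ Δ v x N z ∂gaussianReal m v.toNNReal).toReal ≤
      (Gd μ Δ v x N b).toReal * (gaussianReal m v.toNNReal).real S + (N + 1) * Tl m v b := by
  have : ∫⁻ z in S, Gd μ Δ v x N z ∂gaussianReal m v.toNNReal ≤
      Gd μ Δ v x N b * gaussianReal m v.toNNReal S +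
        ((N + 1 : ℕ) : ENNReal) * gaussianReal m v.toNNReal (Set.Ioi b) := by
    rw [← lintegral_inter_add_sdiff (Gd μ Δ v x N) S (measurableSet_Iic (a := b))]
    refine add_le_add ?_ ?_
    · calc _ ≤ ∫⁻ z in S ∩ Set.Iic b, Gd μ Δ v x N b ∂gaussianReal m v.toNNReal :=
            setLIntegral_mono measurable_const fun z hz => hG.Gd_mono x N hz.2
        _ ≤ _ := by
            rw [setLIntegral_const]; gcongr; exact Set.inter_subset_left
    · calc _ ≤ ∫⁻ z in S \ Set.Iic b, ((N + 1 : ℕ) : ENNReal) ∂gaussianReal m v.toNNReal :=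
            setLIntegral_mono measurable_const fun z hz => hG.Gd_le x N z
        _ ≤ _ := by
            rw [setLIntegral_const]; gcongr; intro z hz; simpa using hz.2
  have h2 := ENNReal.toReal_mono (by
    refine ENNReal.add_ne_top.2 ⟨ENNReal.mul_ne_top (hG.Gfin x N b) (measure_ne_top _ _),
      ENNReal.mul_ne_top (ENNReal.natCast_ne_top _) (measure_ne_top _ _)⟩) this
  rw [ENNReal.toReal_add (ENNReal.mul_ne_top (hG.Gfin x N b) (measure_ne_top _ _))
    (ENNReal.mul_ne_top (ENNReal.natCast_ne_top _) (measure_ne_top _ _)), ENNReal.toReal_mul,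
    ENNReal.toReal_mul, ENNReal.toReal_natCast, Nat.cast_succ] at h2
  simpa [Tl, Measure.real] using h2

lemma Q_up (hG : GV μ Δ v) (x : ℕ → I) (N : ℕ) (l b b' : ℝ) :
    μ.real {h | b < Mx x N h} * Tl (l * v) v b' ≤
      exp (-(l ^ 2 * v / 2)) * (∫ h, exp (l * Mx x N h) ∂μ) * Tl 0 v b + (N + 1) * Tl 0 v b' := by
  have h1 : exp (-(l ^ 2 * v / 2)) * (∫ h, exp (l * Mx x N h) ∂μ) =
      (∫⁻ z, Gd μ Δ v x N z ∂gaussianReal (l * v) v.toNNReal).toReal := by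
    rw [hG.J_eq, ← mul_assoc, ← exp_add]; simp
  have h2 := (hG.I1 x N (l * v) b').trans
    (ENNReal.toReal_mono (hG.Jfin x N (l * v)) (setLIntegral_le_lintegral _ _))
  have h3 := hG.I2 x N 0 b' (Set.Ioi b) measurableSet_Ioi
  rw [← hG.max_tail] at h3
  rw [h1]
  change μ.real {h | b < Mx x N h} ≤ _ * Tl 0 v b + _ at h3
  have t1 := Tl_nonneg (l * v) v b'
  have t2 := Tl_le_one (l * v) v b'
  have t3 := Tl_nonneg 0 v b
  have t4 := Tl_nonneg 0 v b'
  have t5 := mul_le_mul_of_nonneg_right h3 t1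
  have t6 := mul_le_mul_of_nonneg_right h2 t3
  have t7 : (N + 1) * Tl 0 v b' * Tl (l * v) v b' ≤ (N + 1) * Tl 0 v b' :=
    mul_le_of_le_one_right (by positivity) t2
  linarith

lemma Q_low (hG : GV μ Δ v) (x : ℕ → I) (N : ℕ) (l b : ℝ) :
    (exp (-(l ^ 2 * v / 2)) * (∫ h, exp (l * Mx x N h) ∂μ) - (N + 1) * Tl (l * v) v b) *
      Tl 0 v b ≤ μ.real {h | b < Mx x N h} := by
  have h1 : exp (-(l ^ 2 * v / 2)) * (∫ h, exp (l * Mx x N h) ∂μ) =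
      (∫⁻ z, Gd μ Δ v x N z ∂gaussianReal (l * v) v.toNNReal).toReal := by
    rw [hG.J_eq, ← mul_assoc, ← exp_add]; simp
  have h2 := hG.I1 x N 0 b
  rw [← hG.max_tail] at h2
  have h3 := hG.I2 x N (l * v) b Set.univ MeasurableSet.univ
  rw [Measure.restrict_univ] at h3
  rw [h1]
  have : (gaussianReal (l * v) v.toNNReal).real Set.univ = 1 := by simp
  rw [this] at h3
  refine le_trans ?_ h2
  have t3 := Tl_nonneg 0 v b
  exact mul_le_mul_of_nonneg_right (by linarith) t3
end
end GV

section
variable {n p : ℕ} {μ : Measure (V n → ℝ)}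

/-- Averaged tail of the maximum over a block. -/
noncomputable def Qn (n : ℕ) (μ : Measure (V n → ℝ)) (N : ℕ) (b : ℝ) : ℝ :=
  Ek n (N + 1) (fun y => μ.real {h | b < Mx (fun i => y (i + 1)) N h})

lemma Qn_up (hn : n ≠ 0) (hG : GV μ (Dl n p) n) (N : ℕ) (l b b' : ℝ) (hl : 0 ≤ l) :
    Qn n μ N b * Tl (l * n) n b' ≤
      (1 + l * √((N + 1) * n) + N * (2 * p) * l ^ 2) * Tl 0 n b + (N + 1) * Tl 0 n b' := by
  have h := Ek_mono (n := n) (N + 1) _ _ fun y _ => hG.Q_up (fun i => y (i + 1)) N l b b'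
  have h1 : ∀ y : ℕ → V n, μ.real {h | b < Mx (fun i => y (i + 1)) N h} * Tl (l * n) n b' =
    Tl (l * n) n b' * μ.real {h | b < Mx (fun i => y (i + 1)) N h} := fun y => mul_comm _ _
  have h2 : ∀ y : ℕ → V n, exp (-(l ^ 2 * n / 2)) *
      (∫ h, exp (l * Mx (fun i => y (i + 1)) N h) ∂μ) * Tl 0 n b =
      (exp (-(l ^ 2 * n / 2)) * Tl 0 n b) * (∫ h, exp (l * Mx (fun i => y (i + 1)) N h) ∂μ) :=
    fun y => by ring
  simp_rw [h1, h2] at h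
  rw [Ek_mul, Ek_add, Ek_mul, Ek_const hn] at h
  have h3 := up_avg hn hG N l hl
  have h4 : 0 ≤ exp (-(l ^ 2 * n / 2)) * Tl 0 n b := mul_nonneg (exp_nonneg _) (Tl_nonneg _ _ _)
  have h5 := mul_le_mul_of_nonneg_left h3 h4
  have h6 : exp (-(l ^ 2 * n / 2)) * exp (l ^ 2 * n / 2) = 1 := by rw [← exp_add]; simp
  have h7 : exp (-(l ^ 2 * n / 2)) * Tl 0 n b *
    (exp (l ^ 2 * n / 2) * (1 + l * √((N + 1) * n) + N * (2 * p) * l ^ 2)) =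
    (1 + l * √((N + 1) * n) + N * (2 * p) * l ^ 2) * Tl 0 n b := by
    linear_combination (Tl 0 n b * (1 + l * √((N + 1) * n) + N * (2 * p) * l ^ 2)) * h6
  unfold Qn
  linarith

lemma Qn_low (hn : n ≠ 0) (hp : 2 ≤ p) (hG : GV μ (Dl n p) n) (N L : ℕ) (l η b : ℝ)
    (hl : 0 ≤ l) (hl1 : l ≤ 1 / 2) (hη : 0 < η) (hη2 : η ≤ 2)
    (hρ : 0 ≤ 1 - 2 * ((L : ℝ) + 1) / n) :
    (((1 - η / 2) * l ^ 2 *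
        (N * (2 * p * (1 - 2 * ((L : ℝ) + 1) / n) ^ (p - 1) - 4 * p * (L / n))) -
        N * (l ^ 4 / (2 * η ^ 2) * (48 * exp (2 * (2 * p)))) -
        N * (N * (2 * (exp (-(l ^ 2 / 2 / 4)) ^ L + (N + 1) * exp (l ^ 2 / 2 - l ^ 2 / 2 * n / 4)))))
      - (N + 1) * Tl (l * n) n b) * Tl 0 n b ≤ Qn n μ N b := by
  have h := Ek_mono (n := n) (N + 1) _ _ fun y _ => hG.Q_low (fun i => y (i + 1)) N l b
  have h2 : ∀ y : ℕ → V n, (exp (-(l ^ 2 * n / 2)) *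
      (∫ h, exp (l * Mx (fun i => y (i + 1)) N h) ∂μ) - (N + 1) * Tl (l * n) n b) * Tl 0 n b =
      (exp (-(l ^ 2 * n / 2)) * Tl 0 n b) * (∫ h, exp (l * Mx (fun i => y (i + 1)) N h) ∂μ) +
        (- ((N + 1) * Tl (l * n) n b * Tl 0 n b)) :=
    fun y => by ring
  simp_rw [h2] at h
  rw [Ek_add, Ek_mul, Ek_const hn] at h
  have h3 := low_avg hn hp hG N L l η hl hl1 hη hη2 hρ
  have h4 : 0 ≤ exp (-(l ^ 2 * n / 2)) * Tl 0 n b := mul_nonneg (exp_nonneg _) (Tl_nonneg _ _ _)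
  have h5 := mul_le_mul_of_nonneg_left h3 h4
  have h6 : exp (-(l ^ 2 * n / 2)) * exp (l ^ 2 * n / 2) = 1 := by rw [← exp_add]; simp
  rw [show ∀ a b c d : ℝ, a * b * (c * d) = (a * c) * (d * b) by intros; ring, h6, one_mul] at h5
  unfold Qn
  linarith
end

lemma Tl_chernoff (m v b : ℝ) (hv : 0 < v) (hb : m ≤ b) :
    Tl m v b ≤ exp (-((b - m) ^ 2 / (2 * v))) := by
  have h := measure_ge_le_exp_mul_mgf (μ := gaussianReal m v.toNNReal) (X := id) b
    (t := (b - m) / v) (div_nonneg (by linarith) hv.le) (integrable_exp_mul_gaussianReal _)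
  rw [mgf_id_gaussianReal] at h
  simp only [Real.coe_toNNReal v hv.le] at h
  rw [← exp_add] at h
  have h0 : Tl m v b ≤ (gaussianReal m v.toNNReal).real {ω | b ≤ id ω} :=
    measureReal_mono (fun z hz => (le_of_lt (show b < z from hz) : b ≤ z)) (measure_ne_top _ _)
  refine h0.trans (h.trans (exp_le_exp.2 (le_of_eq ?_)))
  field_simp
  ring

lemma Tl_lower (m v b : ℝ) (hv : 0 < v) (hb : b ≤ m) :
    1 - exp (-((b - m) ^ 2 / (2 * v))) ≤ Tl m v b := by
  have h := measure_le_le_exp_mul_mgf (μ := gaussianReal m v.toNNReal) (X := id) b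
    (t := (b - m) / v) (div_nonpos_of_nonpos_of_nonneg (by linarith) hv.le)
    (integrable_exp_mul_gaussianReal _)
  rw [mgf_id_gaussianReal] at h
  simp only [Real.coe_toNNReal v hv.le] at h
  rw [← exp_add] at h
  have h2 : Tl m v b = 1 - (gaussianReal m v.toNNReal).real (Set.Iic b) := by
    unfold Tl
    rw [← probReal_compl_eq_one_sub measurableSet_Iic, Set.compl_Iic]
  have h3 : (gaussianReal m v.toNNReal).real (Set.Iic b) ≤ _ := h
  have h4 : -((b - m) / v) * b + (m * ((b - m) / v) + v * ((b - m) / v) ^ 2 / 2) =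
      -((b - m) ^ 2 / (2 * v)) := by
    field_simp
    ring
  rw [h4] at h3
  linarith

lemma Tl_formula (v γ s : ℝ) (hv : 0 < v) (hγ : 0 < γ) :
    √(2 * π * v) * γ⁻¹ * exp (γ ^ 2 * v / 2) * γ ^ 2 * Tl 0 v (γ * v + s / γ) =
      exp (-s) * ∫ w in Set.Ioi (0 : ℝ), exp (-w) * exp (-((s + w) ^ 2 / (2 * (γ ^ 2 * v)))) := by
  set b := γ * v + s / γ with hb
  have hv0 : v.toNNReal ≠ 0 := by simpa using hv
  have h1 : Tl 0 v b = ∫ z in Set.Ioi b, gaussianPDFReal 0 v.toNNReal z := by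
    unfold Tl Measure.real
    rw [gaussianReal_apply_eq_integral _ hv0, ENNReal.toReal_ofReal]
    exact integral_nonneg fun z => gaussianPDFReal_nonneg _ _ _
  have h2 : ∫ w in Set.Ioi (0 : ℝ), gaussianPDFReal 0 v.toNNReal (b + w / γ) = γ * Tl 0 v b := by
    rw [h1, ← integral_indicator measurableSet_Ioi, ← integral_indicator measurableSet_Ioi]
    have e : (Set.Ioi (0 : ℝ)).indicator (fun w => gaussianPDFReal 0 v.toNNReal (b + w / γ)) =
        fun w => (fun z => (Set.Ioi b).indicator (gaussianPDFReal 0 v.toNNReal) (b + z)) (w / γ) := by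
      funext w
      by_cases hw : 0 < w
      · have : 0 < w / γ := by positivity
        simp [hw, Set.indicator, this]
      · have : ¬ 0 < w / γ := by rw [div_pos_iff_of_pos_right hγ]; exact hw
        simp [hw, Set.indicator, this]
    rw [e, Measure.integral_comp_div (fun z => (Set.Ioi b).indicator (gaussianPDFReal 0 v.toNNReal) (b + z)),
      integral_add_left_eq_self, abs_of_pos hγ, smul_eq_mul]
  have h3 : ∀ w : ℝ, gaussianPDFReal 0 v.toNNReal (b + w / γ) =
      (√(2 * π * v))⁻¹ * exp (-(γ ^ 2 * v / 2)) * exp (-s) *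
        (exp (-w) * exp (-((s + w) ^ 2 / (2 * (γ ^ 2 * v))))) := fun w => by
    rw [gaussianPDFReal_def]
    simp only [Real.coe_toNNReal v hv.le]
    rw [show ∀ a b c d e : ℝ, a * b * c * (d * e) = a * (b * c * (d * e)) by intros; ring,
      ← exp_add, ← exp_add, ← exp_add]
    congr 2
    rw [hb]
    field_simp
    ring
  simp_rw [h3] at h2
  rw [integral_const_mul] at h2
  have h4 : √(2 * π * v) ≠ 0 := by positivity
  have h5 : exp (γ ^ 2 * v / 2) * exp (-(γ ^ 2 * v / 2)) = 1 := by rw [← exp_add]; simp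
  have h6 : √(2 * π * v) * γ⁻¹ * exp (γ ^ 2 * v / 2) * γ ^ 2 * Tl 0 v b =
      √(2 * π * v) * exp (γ ^ 2 * v / 2) * (γ * Tl 0 v b) := by field_simp
  rw [h6, ← h2]
  set K := ∫ w in Set.Ioi (0 : ℝ), exp (-w) * exp (-((s + w) ^ 2 / (2 * (γ ^ 2 * v))))
  calc _ = (√(2 * π * v) * (√(2 * π * v))⁻¹) * (exp (γ ^ 2 * v / 2) * exp (-(γ ^ 2 * v / 2))) *
        (exp (-s) * K) := by ring
    _ = _ := by rw [h5, mul_inv_cancel₀ h4]; ring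

lemma int_lim (s : ℕ → ℝ) (s0 : ℝ) (hs : Tendsto s atTop (nhds s0)) (W : ℕ → ℝ)
    (hW : Tendsto W atTop atTop) :
    Tendsto (fun n => exp (-s n) * ∫ w in Set.Ioi (0 : ℝ),
      exp (-w) * exp (-((s n + w) ^ 2 / (2 * W n)))) atTop (nhds (exp (-s0))) := by
  have h : Tendsto (fun n => ∫ w in Set.Ioi (0 : ℝ),
      exp (-w) * exp (-((s n + w) ^ 2 / (2 * W n)))) atTop
        (nhds (∫ w in Set.Ioi (0 : ℝ), exp (-w))) := by
    refine tendsto_integral_filter_of_dominated_convergence (fun w => exp (-w)) ?_ ?_ ?_ ?_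
    · exact Eventually.of_forall fun n => Measurable.aestronglyMeasurable (by fun_prop)
    · filter_upwards [hW.eventually_gt_atTop 0] with n hn
      refine ae_of_all _ fun w => ?_
      rw [Real.norm_of_nonneg (by positivity)]
      refine mul_le_of_le_one_right (exp_nonneg _) (exp_le_one_iff.2 ?_)
      have : 0 ≤ (s n + w) ^ 2 / (2 * W n) := by positivity
      linarith
    · exact integrableOn_exp_neg_Ioi 0
    · refine ae_of_all _ fun w => ?_
      have h1 : Tendsto (fun n => (s n + w) ^ 2 / (2 * W n)) atTop (nhds 0) :=
        Tendsto.div_atTop ((hs.add_const w).pow 2) (hW.const_mul_atTop (by norm_num))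
      have h2 := (continuous_exp.tendsto _).comp h1.neg
      simpa using h2.const_mul (exp (-w))
  rw [integral_exp_neg_Ioi_zero] at h
  simpa using ((continuous_exp.tendsto _).comp hs.neg).mul h

lemma tz (a b k : ℝ) (hb : 0 < b) (hk : 0 < k) :
    Tendsto (fun n : ℕ => (n : ℝ) ^ a * exp (-(k * (n : ℝ) ^ b))) atTop (nhds 0) := by
  have h := (tendsto_rpow_mul_exp_neg_mul_atTop_nhds_zero (a / b) k hk).comp
    ((tendsto_rpow_atTop hb).comp tendsto_natCast_atTop_atTop)
  refine h.congr fun n => ?_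
  simp only [Function.comp]
  rw [← rpow_mul (by positivity), mul_div_cancel₀ _ hb.ne']
  ring_nf

section asym
variable {c : ℝ}

lemma γ_pos (c : ℝ) {n : ℕ} (hn : n ≠ 0) : 0 < γseq c n := by
  unfold γseq; positivity

lemma γ_tendsto (hc0 : 0 < c) : Tendsto (γseq c) atTop (nhds 0) :=
  (tendsto_rpow_neg_atTop hc0).comp tendsto_natCast_atTop_atTop

lemma γW (c : ℝ) {n : ℕ} (hn : n ≠ 0) : γseq c n ^ 2 * n = (n : ℝ) ^ (1 - 2 * c) := by
  have h : (0 : ℝ) < n := by positivity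
  unfold γseq
  rw [← rpow_natCast, ← rpow_mul h.le]
  nth_rewrite 2 [← rpow_one (n : ℝ)]
  rw [← rpow_add h]; congr 1; push_cast; ring

lemma γinv (c : ℝ) (n : ℕ) : (γseq c n)⁻¹ = (n : ℝ) ^ c := by
  unfold γseq
  rw [rpow_neg (by positivity), inv_inv]

lemma γinv2 (c : ℝ) (n : ℕ) : (γseq c n ^ 2)⁻¹ = (n : ℝ) ^ (2 * c) := by
  rw [← inv_pow, γinv, ← rpow_natCast, ← rpow_mul (by positivity)]
  congr 1; push_cast; ring

lemma W_tendsto (hc1 : c < 1 / 2) : Tendsto (fun n : ℕ => γseq c n ^ 2 * n) atTop atTop := by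
  refine ((tendsto_rpow_atTop (y := 1 - 2 * c) (by linarith)).comp
    tendsto_natCast_atTop_atTop).congr' ?_
  filter_upwards [eventually_ne_atTop 0] with n hn
  rw [γW c hn]; rfl

/-- small auxiliary sequence -/
noncomputable def dl (c : ℝ) (n : ℕ) : ℝ := (n : ℝ) ^ (-((1 - 2 * c) / 4))

lemma dl_pos (c : ℝ) {n : ℕ} (hn : n ≠ 0) : 0 < dl c n := by unfold dl; positivity

lemma dl_tendsto (hc1 : c < 1 / 2) : Tendsto (dl c) atTop (nhds 0) :=
  (tendsto_rpow_neg_atTop (by linarith)).comp tendsto_natCast_atTop_atTop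

lemma dlW1 (c : ℝ) {n : ℕ} (hn : n ≠ 0) :
    dl c n * (γseq c n ^ 2 * n) = (n : ℝ) ^ (3 * (1 - 2 * c) / 4) := by
  have h : (0 : ℝ) < n := by positivity
  rw [γW c hn]; unfold dl
  rw [← rpow_add h]; congr 1; ring

lemma dlW2 (c : ℝ) {n : ℕ} (hn : n ≠ 0) :
    dl c n ^ 2 * (γseq c n ^ 2 * n) = (n : ℝ) ^ ((1 - 2 * c) / 2) := by
  have h : (0 : ℝ) < n := by positivity
  rw [pow_two, mul_assoc, dlW1 c hn]; unfold dl
  rw [← rpow_add h]; congr 1; ring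

lemma θcast {n : ℕ} (hn : n ≠ 0) : (((θseq n - 1 : ℕ) : ℝ) + 1) = 3 * (n : ℝ) ^ 2 := by
  have : θseq n - 1 + 1 = 3 * n ^ 2 := by
    have : 0 < n ^ 2 := by positivity
    unfold θseq; omega
  exact_mod_cast this

lemma θcast' {n : ℕ} (hn : n ≠ 0) : ((θseq n - 1 : ℕ) : ℝ) = 3 * (n : ℝ) ^ 2 - 1 := by
  have := θcast hn; linarith

lemma inv_n : Tendsto (fun n : ℕ => 1 / (n : ℝ)) atTop (nhds 0) := tendsto_one_div_atTop_nhds_zero_nat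

lemma tail_lim (hc1 : c < 1 / 2) (s : ℕ → ℝ) (s0 : ℝ) (hs : Tendsto s atTop (nhds s0)) :
    Tendsto (fun n => aseq c n * γseq c n ^ 2 * Tl 0 n (γseq c n * n + s n / γseq c n))
      atTop (nhds (exp (-s0))) := by
  refine (int_lim s s0 hs _ (W_tendsto hc1)).congr' ?_
  filter_upwards [eventually_ne_atTop 0] with n hn
  rw [← Tl_formula n (γseq c n) (s n) (by positivity) (γ_pos c hn)]
  rfl

lemma Rθ : Tendsto (fun n : ℕ => ((θseq n - 1 : ℕ) : ℝ) / (3 * (n : ℝ) ^ 2)) atTop (nhds 1) := by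
  have h : Tendsto (fun n : ℕ => 1 - (1 / (n : ℝ)) ^ 2 / 3) atTop (nhds (1 - 0 ^ 2 / 3)) :=
    ((inv_n.pow 2).div_const 3).const_sub 1
  simp only [ne_eq, OfNat.ofNat_ne_zero, not_false_eq_true, zero_pow, zero_div, sub_zero] at h
  refine h.congr' ?_
  filter_upwards [eventually_ne_atTop 0] with n hn
  have : (n : ℝ) ≠ 0 := by positivity
  rw [θcast' hn]; field_simp

lemma U_lim (p : ℕ) (hc1 : c < 1 / 2) :
    Tendsto (fun n : ℕ => (1 + (1 + 2 * dl c n) * γseq c n * √((((θseq n - 1 : ℕ) : ℝ) + 1) * n) +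
      ((θseq n - 1 : ℕ) : ℝ) * (2 * p) * ((1 + 2 * dl c n) * γseq c n) ^ 2) /
        (3 * (n : ℝ) ^ 2 * γseq c n ^ 2)) atTop (nhds (2 * (p : ℝ))) := by
  have hW : Tendsto (fun n : ℕ => (γseq c n ^ 2 * n)⁻¹) atTop (nhds 0) :=
    (W_tendsto hc1).inv_tendsto_atTop
  have h1 := (hW.mul inv_n).div_const 3
  have hd : Tendsto (fun n => 1 + 2 * dl c n) atTop (nhds 1) := by
    simpa using ((dl_tendsto hc1).const_mul 2).const_add 1
  have h2 := hd.mul ((continuous_sqrt.tendsto _).comp (hW.div_const 3))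
  have h3 := (Rθ.mul_const (2 * (p : ℝ))).mul (hd.pow 2)
  have h := (h1.add h2).add h3
  simp only [mul_zero, zero_div, sqrt_zero, zero_add, one_pow, one_mul, mul_one] at h
  refine h.congr' ?_
  filter_upwards [eventually_ne_atTop 0] with n hn
  have hn' : (0 : ℝ) < n := by positivity
  have hγ := γ_pos c hn
  rw [θcast hn]
  have e : √(3 * (n : ℝ) ^ 2 * n) = 3 * n ^ 2 * γseq c n * √((γseq c n ^ 2 * n)⁻¹ / 3) := by
    rw [show 3 * (n : ℝ) ^ 2 * n = (3 * n ^ 2 * γseq c n) ^ 2 * ((γseq c n ^ 2 * n)⁻¹ / 3) by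
      field_simp, sqrt_mul (by positivity), sqrt_sq (by positivity)]
  rw [e]
  simp only [Function.comp]
  field_simp
end asym

section asym
variable {c : ℝ}

noncomputable def Lq (c : ℝ) (n : ℕ) : ℕ := ⌈(n : ℝ) ^ (c + 1 / 2)⌉₊

lemma Lq_tendsto (hc1 : c < 1 / 2) : Tendsto (fun n : ℕ => (Lq c n : ℝ) / n) atTop (nhds 0) := by
  have h1 : Tendsto (fun n : ℕ => (n : ℝ) ^ (-(1 / 2 - c)) + 1 / (n : ℝ)) atTop (nhds 0) := by
    simpa using ((tendsto_rpow_neg_atTop (y := 1 / 2 - c) (by linarith)).comp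
      tendsto_natCast_atTop_atTop).add inv_n
  refine squeeze_zero' (Eventually.of_forall fun n => by positivity) ?_ h1
  filter_upwards [eventually_ne_atTop 0] with n hn
  have hn' : (0 : ℝ) < n := by positivity
  have h2 : (Lq c n : ℝ) ≤ (n : ℝ) ^ (c + 1 / 2) + 1 := (Nat.ceil_lt_add_one (by positivity)).le
  rw [div_le_iff₀ hn', add_mul, div_mul_cancel₀ _ hn'.ne']
  refine h2.trans (add_le_add (le_of_eq ?_) le_rfl)
  nth_rewrite 3 [← rpow_one (n : ℝ)]
  rw [← rpow_add hn']; congr 1; ring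

lemma dl_small (hc1 : c < 1 / 2) : ∀ᶠ n in atTop, dl c n ≤ 1 / 4 :=
  (dl_tendsto hc1).eventually_le_const (by norm_num)

lemma γ_small (hc0 : 0 < c) : ∀ᶠ n in atTop, γseq c n ≤ 1 / 2 :=
  (γ_tendsto hc0).eventually_le_const (by norm_num)

lemma rpow_split {n : ℕ} (hn : n ≠ 0) (k : ℕ) (a : ℝ) :
    (n : ℝ) ^ k * (n : ℝ) ^ a = (n : ℝ) ^ ((k : ℝ) + a) := by
  have hn' : (0 : ℝ) < n := by positivity
  rw [rpow_add hn', rpow_natCast]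

lemma t3_lim (hc0 : 0 < c) (hc1 : c < 1 / 2) :
    Tendsto (fun n : ℕ => ((θseq n - 1 : ℕ) : ℝ) * (((θseq n - 1 : ℕ) : ℝ) *
      (2 * (exp (-(((1 - 2 * dl c n) * γseq c n) ^ 2 / 2 / 4)) ^ (Lq c n) +
        (((θseq n - 1 : ℕ) : ℝ) + 1) * exp (((1 - 2 * dl c n) * γseq c n) ^ 2 / 2 -
          ((1 - 2 * dl c n) * γseq c n) ^ 2 / 2 * n / 4)))) / (3 * (n : ℝ) ^ 2 * γseq c n ^ 2))
      atTop (nhds 0) := by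
  have h1 : Tendsto (fun n : ℕ => 6 * ((n : ℝ) ^ ((2 : ℕ) + 2 * c) * exp (-(1 / 32 * (n : ℝ) ^ (1 / 2 - c)))) +
      18 * exp 1 * ((n : ℝ) ^ ((4 : ℕ) + 2 * c) * exp (-(1 / 32 * (n : ℝ) ^ (1 - 2 * c)))))
      atTop (nhds 0) := by
    simpa using ((tz ((2 : ℕ) + 2 * c) (1 / 2 - c) (1 / 32) (by linarith) (by norm_num)).const_mul 6).add
      ((tz ((4 : ℕ) + 2 * c) (1 - 2 * c) (1 / 32) (by linarith) (by norm_num)).const_mul (18 * exp 1))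
  refine squeeze_zero' (Eventually.of_forall fun n => by positivity) ?_ h1
  filter_upwards [eventually_ne_atTop 0, dl_small hc1, γ_small hc0] with n hn hd hγ2
  have hn' : (0 : ℝ) < n := by positivity
  have hn1 : (1 : ℝ) ≤ n := by exact_mod_cast Nat.one_le_iff_ne_zero.2 hn
  have hγ := γ_pos c hn
  have hd0 := dl_pos c hn
  rw [θcast hn]
  set l := (1 - 2 * dl c n) * γseq c n with hl
  have hl1 : γseq c n / 2 ≤ l := by rw [hl]; nlinarith
  have hl2 : l ≤ 1 := by rw [hl]; nlinarith
  have hl0 : 0 < l := lt_of_lt_of_le (by positivity) hl1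
  have hlsq : γseq c n ^ 2 / 4 ≤ l ^ 2 := by nlinarith
  have hA : exp (-(l ^ 2 / 2 / 4)) ^ (Lq c n) ≤ exp (-(1 / 32 * (n : ℝ) ^ (1 / 2 - c))) := by
    rw [← exp_nat_mul]
    apply exp_le_exp.2
    have h2 : (n : ℝ) ^ (c + 1 / 2) ≤ Lq c n := Nat.le_ceil _
    have h3 : γseq c n ^ 2 * (n : ℝ) ^ (c + 1 / 2) = (n : ℝ) ^ (1 / 2 - c) := by
      unfold γseq
      rw [← rpow_natCast, ← rpow_mul hn'.le, ← rpow_add hn']; congr 1; push_cast; ring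
    have h4 : γseq c n ^ 2 / 4 * (n : ℝ) ^ (c + 1 / 2) ≤ l ^ 2 * Lq c n :=
      mul_le_mul hlsq h2 (by positivity) (by positivity)
    nlinarith
  have hB : exp (l ^ 2 / 2 - l ^ 2 / 2 * n / 4) ≤ exp 1 * exp (-(1 / 32 * (n : ℝ) ^ (1 - 2 * c))) := by
    rw [← exp_add]
    apply exp_le_exp.2
    rw [← γW c hn]
    have : γseq c n ^ 2 / 4 * n ≤ l ^ 2 * n := mul_le_mul_of_nonneg_right hlsq hn'.le
    nlinarith
  have hN : ((θseq n - 1 : ℕ) : ℝ) ≤ 3 * (n : ℝ) ^ 2 := by rw [θcast' hn]; linarith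
  rw [div_le_iff₀ (by positivity)]
  calc _ ≤ 3 * (n : ℝ) ^ 2 * (3 * (n : ℝ) ^ 2 * (2 * (exp (-(1 / 32 * (n : ℝ) ^ (1 / 2 - c))) +
        3 * (n : ℝ) ^ 2 * (exp 1 * exp (-(1 / 32 * (n : ℝ) ^ (1 - 2 * c))))))) := by gcongr
    _ = _ := by
      rw [← rpow_split hn, ← rpow_split hn, ← γinv2]
      field_simp
      ring

lemma S_lim (hc1 : c < 1 / 2) (s : ℕ → ℝ) (s0 : ℝ) (hs : Tendsto s atTop (nhds s0)) :
    Tendsto (fun n : ℕ => (γseq c n ^ 2)⁻¹ * Tl ((1 - 2 * dl c n) * γseq c n * n) n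
      (γseq c n * n + s n / γseq c n)) atTop (nhds 0) := by
  have h1 := tz (2 * c) ((1 - 2 * c) / 2) (1 / 2) (by linarith) (by norm_num)
  refine squeeze_zero' (Eventually.of_forall fun n => mul_nonneg (by positivity) (Tl_nonneg _ _ _)) ?_ h1
  have h2 : Tendsto (fun n : ℕ => (n : ℝ) ^ (3 * (1 - 2 * c) / 4)) atTop atTop :=
    (tendsto_rpow_atTop (by linarith)).comp tendsto_natCast_atTop_atTop
  filter_upwards [eventually_ne_atTop 0, hs.eventually (eventually_ge_nhds (sub_one_lt s0)),
    h2.eventually_ge_atTop (-(s0 - 1))] with n hn hs1 hb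
  have hn' : (0 : ℝ) < n := by positivity
  have hγ := γ_pos c hn
  have hd0 := dl_pos c hn
  rw [← dlW1 c hn] at hb
  have hk : dl c n * (γseq c n * n) ≤
      γseq c n * n + s n / γseq c n - (1 - 2 * dl c n) * γseq c n * n := by
    have : -(dl c n * (γseq c n * n)) ≤ s n / γseq c n := by
      rw [le_div_iff₀ hγ]; nlinarith
    nlinarith
  rw [γinv2]
  refine mul_le_mul_of_nonneg_left ?_ (by positivity)
  have h0 : 0 ≤ dl c n * (γseq c n * n) := by positivity
  refine (Tl_chernoff _ _ _ hn' (by linarith)).trans (exp_le_exp.2 (neg_le_neg ?_))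
  rw [← dlW2 c hn, le_div_iff₀ (by positivity)]
  have := pow_le_pow_left₀ h0 hk 2
  nlinarith

lemma A_lim (p : ℕ) (hc0 : 0 < c) (hc1 : c < 1 / 2) (s : ℕ → ℝ) (s0 : ℝ)
    (hs : Tendsto s atTop (nhds s0)) :
    Tendsto (fun n : ℕ => (((1 - √(γseq c n) / 2) * ((1 - 2 * dl c n) * γseq c n) ^ 2 *
        (((θseq n - 1 : ℕ) : ℝ) * (2 * p * (1 - 2 * ((Lq c n : ℝ) + 1) / n) ^ (p - 1) -
          4 * p * ((Lq c n : ℝ) / n))) -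
        ((θseq n - 1 : ℕ) : ℝ) * (((1 - 2 * dl c n) * γseq c n) ^ 4 / (2 * √(γseq c n) ^ 2) *
          (48 * exp (2 * (2 * p)))) -
        ((θseq n - 1 : ℕ) : ℝ) * (((θseq n - 1 : ℕ) : ℝ) *
      (2 * (exp (-(((1 - 2 * dl c n) * γseq c n) ^ 2 / 2 / 4)) ^ (Lq c n) +
        (((θseq n - 1 : ℕ) : ℝ) + 1) * exp (((1 - 2 * dl c n) * γseq c n) ^ 2 / 2 -
          ((1 - 2 * dl c n) * γseq c n) ^ 2 / 2 * n / 4)))))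
      - (((θseq n - 1 : ℕ) : ℝ) + 1) * Tl ((1 - 2 * dl c n) * γseq c n * n) n
          (γseq c n * n + s n / γseq c n)) / (3 * (n : ℝ) ^ 2 * γseq c n ^ 2))
      atTop (nhds (2 * (p : ℝ))) := by
  have hγ := γ_tendsto hc0
  have hsq : Tendsto (fun n => 1 - √(γseq c n) / 2) atTop (nhds 1) := by
    simpa using (((continuous_sqrt.tendsto _).comp hγ).div_const 2).const_sub 1
  have hd : Tendsto (fun n => 1 - 2 * dl c n) atTop (nhds 1) := by
    simpa using ((dl_tendsto hc1).const_mul 2).const_sub 1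
  have hL := Lq_tendsto (c := c) hc1
  have hρ : Tendsto (fun n : ℕ => 1 - 2 * ((Lq c n : ℝ) / n + 1 / n)) atTop (nhds 1) := by
    simpa using ((hL.add inv_n).const_mul 2).const_sub 1
  have h1 := ((hsq.mul (hd.pow 2)).mul Rθ).mul
    (((hρ.pow (p - 1)).const_mul (2 * (p : ℝ))).sub (hL.const_mul (4 * (p : ℝ))))
  have h2 := ((Rθ.mul (hd.pow 4)).mul hγ).mul_const (1 / 2 * (48 * exp (2 * (2 * p))))
  have h := ((h1.sub h2).sub (t3_lim hc0 hc1)).sub (S_lim hc1 s s0 hs)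
  simp only [one_pow, mul_one, one_mul, mul_zero, zero_mul, sub_zero] at h
  refine h.congr' ?_
  filter_upwards [eventually_ne_atTop 0] with n hn
  have hn' : (0 : ℝ) < n := by positivity
  have hγ0 := γ_pos c hn
  rw [sq_sqrt hγ0.le, sub_div, sub_div, sub_div]
  congr 1
  · congr 1
    congr 1
    · rw [show 1 - 2 * ((Lq c n : ℝ) / n + 1 / n) = 1 - 2 * ((Lq c n : ℝ) + 1) / n by ring]
      field_simp
    · field_simp
  · rw [θcast hn]
    field_simp
end asym

section asym
variable {c : ℝ}

lemma aseq_nonneg (c : ℝ) (n : ℕ) : 0 ≤ aseq c n := by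
  unfold aseq γseq; positivity

lemma aT_lim (hc1 : c < 1 / 2) :
    Tendsto (fun n : ℕ => aseq c n * Tl 0 n ((1 + dl c n) * γseq c n * n)) atTop (nhds 0) := by
  have h1 : Tendsto (fun n : ℕ => √(2 * π) * ((n : ℝ) ^ (1 / 2 + c) *
      exp (-(1 * (n : ℝ) ^ (3 * (1 - 2 * c) / 4))))) atTop (nhds 0) := by
    simpa using (tz (1 / 2 + c) (3 * (1 - 2 * c) / 4) 1 (by linarith) (by norm_num)).const_mul
      (√(2 * π))
  refine squeeze_zero' (Eventually.of_forall fun n =>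
    mul_nonneg (aseq_nonneg c n) (Tl_nonneg _ _ _)) ?_ h1
  filter_upwards [eventually_ne_atTop 0] with n hn
  have hn' : (0 : ℝ) < n := by positivity
  have hγ := γ_pos c hn
  have hd0 := dl_pos c hn
  have h2 := Tl_chernoff 0 n ((1 + dl c n) * γseq c n * n) hn' (by positivity)
  refine (mul_le_mul_of_nonneg_left h2 (aseq_nonneg c n)).trans ?_
  unfold aseq
  rw [γinv, sqrt_mul (by positivity), sqrt_eq_rpow (n : ℝ), mul_assoc (√(2 * π)), ← rpow_add hn',
    mul_assoc, ← exp_add, mul_assoc, ← dlW1 c hn]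
  refine mul_le_mul_of_nonneg_left (mul_le_mul_of_nonneg_left (exp_le_exp.2 ?_) (by positivity))
    (by positivity)
  have : ((1 + dl c n) * γseq c n * n - 0) ^ 2 / (2 * n) =
    γseq c n ^ 2 * n / 2 + dl c n * (γseq c n ^ 2 * n) + dl c n ^ 2 * (γseq c n ^ 2 * n) / 2 := by
    field_simp; ring
  rw [this]
  have : 0 ≤ dl c n ^ 2 * (γseq c n ^ 2 * n) := by positivity
  linarith

lemma S1_lim (hc1 : c < 1 / 2) :
    Tendsto (fun n : ℕ => Tl ((1 + 2 * dl c n) * γseq c n * n) n ((1 + dl c n) * γseq c n * n))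
      atTop (nhds 1) := by
  have h1 := tz 0 ((1 - 2 * c) / 2) (1 / 2) (by linarith) (by norm_num)
  have h2 : Tendsto (fun n : ℕ => 1 - (n : ℝ) ^ (0 : ℝ) * exp (-(1 / 2 * (n : ℝ) ^ ((1 - 2 * c) / 2))))
      atTop (nhds 1) := by simpa using h1.const_sub 1
  refine tendsto_of_tendsto_of_tendsto_of_le_of_le' h2 tendsto_const_nhds ?_
    (Eventually.of_forall fun n => Tl_le_one _ _ _)
  filter_upwards [eventually_ne_atTop 0] with n hn
  have hn' : (0 : ℝ) < n := by positivity
  have hγ := γ_pos c hn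
  have hd0 := dl_pos c hn
  have h3 := Tl_lower ((1 + 2 * dl c n) * γseq c n * n) n ((1 + dl c n) * γseq c n * n) hn'
    (by gcongr; linarith)
  refine le_trans (le_of_eq ?_) h3
  rw [rpow_zero, one_mul, ← dlW2 c hn]
  congr 3
  field_simp
  ring

theorem Q_lim (p : ℕ) (hp : 2 ≤ p) (hc0 : 0 < c) (hc1 : c < 1 / 2)
    (μ : ∀ n, Measure (V n → ℝ)) (hG : ∀ n, n ≠ 0 → GV (μ n) (Dl n p) n)
    (s : ℕ → ℝ) (s0 : ℝ) (hs : Tendsto s atTop (nhds s0)) :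
    Tendsto (fun n => aseq c n / (3 * (n : ℝ) ^ 2) *
      Qn n (μ n) (θseq n - 1) (γseq c n * n + s n / γseq c n)) atTop
      (nhds (2 * (p : ℝ) * exp (-s0))) := by
  have hT := tail_lim hc1 s s0 hs
  have hlow := (A_lim p hc0 hc1 s s0 hs).mul hT
  have hup := (((U_lim (c := c) p hc1).mul hT).add (aT_lim hc1)).div (S1_lim hc1) one_ne_zero
  rw [add_zero, div_one] at hup
  refine tendsto_of_tendsto_of_tendsto_of_le_of_le' hlow hup ?_ ?_
  · have hρ : Tendsto (fun n : ℕ => 1 - 2 * ((Lq c n : ℝ) / n + 1 / n)) atTop (nhds 1) := by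
      simpa using (((Lq_tendsto hc1).add inv_n).const_mul 2).const_sub 1
    filter_upwards [eventually_ne_atTop 0, dl_small hc1, γ_small hc0,
      hρ.eventually_const_le one_half_lt_one] with n hn hd hγ2 hr
    have hn' : (0 : ℝ) < n := by positivity
    have hγ := γ_pos c hn
    have hd0 := dl_pos c hn
    have h1 := Qn_low hn hp (hG n hn) (θseq n - 1) (Lq c n) ((1 - 2 * dl c n) * γseq c n)
      (√(γseq c n)) (γseq c n * n + s n / γseq c n) (mul_nonneg (by linarith) hγ.le)
      (by nlinarith) (sqrt_pos.2 hγ) (by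
        rw [sqrt_le_left (by norm_num)]; linarith) (by
        rw [show 1 - 2 * ((Lq c n : ℝ) + 1) / n = 1 - 2 * ((Lq c n : ℝ) / n + 1 / n) by ring]
        linarith)
    have h2 := mul_le_mul_of_nonneg_left h1
      (show 0 ≤ aseq c n / (3 * (n : ℝ) ^ 2) from div_nonneg (aseq_nonneg c n) (by positivity))
    refine le_trans (le_of_eq ?_) h2
    field_simp
  · filter_upwards [eventually_ne_atTop 0, (S1_lim hc1).eventually_const_lt
      (show (1 / 2 : ℝ) < 1 by norm_num)] with n hn hS
    have hn' : (0 : ℝ) < n := by positivity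
    have hγ := γ_pos c hn
    have hd0 := dl_pos c hn
    have h1 := Qn_up hn (hG n hn) (θseq n - 1) ((1 + 2 * dl c n) * γseq c n)
      (γseq c n * n + s n / γseq c n) ((1 + dl c n) * γseq c n * n) (by positivity)
    have h2 := mul_le_mul_of_nonneg_left h1
      (show 0 ≤ aseq c n / (3 * (n : ℝ) ^ 2) from div_nonneg (aseq_nonneg c n) (by positivity))
    rw [Pi.div_apply, le_div_iff₀ (by linarith), mul_assoc]
    refine h2.trans (le_of_eq ?_)
    rw [mul_add]
    congr 1
    · field_simp
    · rw [θcast hn]; field_simp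

/-- number of blocks -/
lemma k_lim (hc1 : c < 1 / 2) (hc0 : 0 < c) (t : ℝ) (ht : 0 < t) :
    Tendsto (fun n => (kseq c n t : ℝ) / (aseq c n / (3 * (n : ℝ) ^ 2))) atTop (nhds t) := by
  have h1 : Tendsto (fun n : ℕ => (3 * (n : ℝ) ^ 2) / aseq c n) atTop (nhds 0) := by
    have h2 : Tendsto (fun n : ℕ => 3 * ((n : ℝ) ^ ((2 : ℕ) + (0 : ℝ)) *
        exp (-(1 / 2 * (n : ℝ) ^ (1 - 2 * c))))) atTop (nhds 0) := by
      simpa using (tz ((2 : ℕ) + 0) (1 - 2 * c) (1 / 2) (by linarith) (by norm_num)).const_mul 3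
    refine squeeze_zero' (Eventually.of_forall fun n => div_nonneg (by positivity) (aseq_nonneg c n)) ?_ h2
    filter_upwards [eventually_ne_atTop 0] with n hn
    have hn' : (0 : ℝ) < n := by positivity
    have hn1 : (1 : ℝ) ≤ n := by exact_mod_cast Nat.one_le_iff_ne_zero.2 hn
    have ha : exp (1 / 2 * (n : ℝ) ^ (1 - 2 * c)) ≤ aseq c n := by
      rw [← γW c hn]
      unfold aseq
      rw [show 1 / 2 * (γseq c n ^ 2 * n) = γseq c n ^ 2 * n / 2 by ring]
      refine le_mul_of_one_le_left (exp_nonneg _) ?_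
      refine one_le_mul_of_one_le_of_one_le ?_ ?_
      · rw [one_le_sqrt]
        nlinarith [pi_gt_three]
      · rw [γinv]; exact one_le_rpow hn1 hc0.le
    rw [← rpow_split hn, rpow_zero, mul_one, exp_neg, ← mul_assoc, ← div_eq_mul_inv]
    gcongr
  have h3 : Tendsto (fun n : ℕ => t - 2 * ((3 * (n : ℝ) ^ 2) / aseq c n)) atTop (nhds t) := by
    simpa using (h1.const_mul 2).const_sub t
  refine tendsto_of_tendsto_of_tendsto_of_le_of_le' h3 tendsto_const_nhds ?_ ?_
  · filter_upwards [eventually_ne_atTop 0] with n hn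
    have hn' : (0 : ℝ) < n := by positivity
    have hn1 : (1 : ℝ) ≤ n := by exact_mod_cast Nat.one_le_iff_ne_zero.2 hn
    have ha : 0 < aseq c n := by
      have := γ_pos c hn
      unfold aseq; positivity
    have hθ : (θseq n : ℝ) = 3 * (n : ℝ) ^ 2 := by unfold θseq; push_cast; ring
    have hθ0 : 0 < θseq n := by unfold θseq; positivity
    have f1 := Nat.lt_floor_add_one (aseq c n * t)
    have f2 : ⌊aseq c n * t⌋₊ < θseq n * (⌊aseq c n * t⌋₊ / θseq n) + θseq n :=
      Nat.lt_mul_div_succ _ hθ0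
    have f3 : (⌊aseq c n * t⌋₊ : ℝ) ≤ 3 * (n : ℝ) ^ 2 * kseq c n t + 3 * (n : ℝ) ^ 2 := by
      rw [← hθ]; unfold kseq; exact_mod_cast f2.le
    rw [le_div_iff₀ (by positivity)]
    have : (t - 2 * (3 * (n : ℝ) ^ 2 / aseq c n)) * (aseq c n / (3 * (n : ℝ) ^ 2)) =
      aseq c n * t / (3 * (n : ℝ) ^ 2) - 2 := by field_simp
    rw [this, sub_le_iff_le_add, div_le_iff₀ (by positivity)]
    nlinarith
  · filter_upwards [eventually_ne_atTop 0] with n hn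
    have hn' : (0 : ℝ) < n := by positivity
    have ha : 0 < aseq c n := by
      have := γ_pos c hn
      unfold aseq; positivity
    have hθ : (θseq n : ℝ) = 3 * (n : ℝ) ^ 2 := by unfold θseq; push_cast; ring
    have f1 := Nat.floor_le (show 0 ≤ aseq c n * t by positivity)
    have f2 : (⌊aseq c n * t⌋₊ / θseq n) * θseq n ≤ ⌊aseq c n * t⌋₊ := Nat.div_mul_le_self _ _
    have f3 : (kseq c n t : ℝ) * (3 * (n : ℝ) ^ 2) ≤ ⌊aseq c n * t⌋₊ := by
      rw [← hθ]; unfold kseq; exact_mod_cast f2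
    rw [div_le_iff₀ (by positivity), ← mul_div_assoc, le_div_iff₀ (by positivity)]
    linarith
end asym

lemma GV_of {Ω : Type*} [MeasurableSpace Ω] (Pe : Measure Ω) [IsProbabilityMeasure Pe] {n p : ℕ}
    (hn : n ≠ 0) (H : V n → Ω → ℝ) (hHm : ∀ x, Measurable (H x))
    (hH : IsCenteredGaussianVector Pe H (fun x y => (n : ℝ) * overlap n x y ^ p)) :
    GV (Pe.map (fun ω x => H x ω)) (Dl n p) n where
  prob := Measure.isProbabilityMeasure_map (measurable_pi_lambda _ hHm).aemeasurable
  gauss := fun a => by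
    rw [Measure.map_map (by fun_prop) (measurable_pi_lambda _ hHm)]
    exact hH a
  symm := fun x y => by unfold Dl; rw [overlap_symm]
  diag := Dl_self
  vpos := by positivity
  bd := abs_Dl_le hn

section bridge
variable {Ω' : Type*} [MeasurableSpace Ω'] {Pw : Measure Ω'} [IsProbabilityMeasure Pw]
    {J : (n : ℕ) → ℕ → Ω' → V n} {e : ℕ → ℕ → Ω' → ℝ}

/-- cylinder -/
def cyl (J : (n : ℕ) → ℕ → Ω' → V n) (e : ℕ → ℕ → Ω' → ℝ) (n m : ℕ)
    (xs : Fin (m + 1) → V n) (ys : Fin (m + 1) → ℝ) : Set Ω' :=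
  {ω' | (∀ k : Fin (m + 1), J n k ω' = xs k) ∧ (∀ k : Fin (m + 1), ys k < e n k ω')}

lemma cyl_meas (hJ : ∀ n i, Measurable (J n i)) (he : ∀ n i, Measurable (e n i)) (n m : ℕ)
    (xs : Fin (m + 1) → V n) (ys : Fin (m + 1) → ℝ) : MeasurableSet (cyl J e n m xs ys) := by
  have : cyl J e n m xs ys = (⋂ k : Fin (m + 1), {ω' | J n k ω' = xs k}) ∩
      ⋂ k : Fin (m + 1), {ω' | ys k < e n k ω'} := by
    ext ω'; simp [cyl]
  rw [this]
  refine MeasurableSet.inter (MeasurableSet.iInter fun k => ?_) (MeasurableSet.iInter fun k => ?_)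
  · exact hJ n k (measurableSet_singleton (xs k))
  · exact measurableSet_lt measurable_const (he n k)

lemma wt_nonneg (n m : ℕ) (xs : Fin (m + 1) → V n) : 0 ≤ wt n m xs := by
  unfold wt
  refine mul_nonneg (by positivity) (Finset.prod_nonneg fun k _ => ?_)
  split_ifs <;> positivity

lemma cyl_law (hlaw : WalkExpLaw Pw J e) (n m : ℕ) (xs : Fin (m + 1) → V n)
    (ys : Fin (m + 1) → ℝ) (hy : ∀ k, 0 ≤ ys k) :
    Pw.real (cyl J e n m xs ys) = wt n m xs * exp (-∑ k, ys k) := by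
  unfold Measure.real
  rw [show Pw (cyl J e n m xs ys) = _ from hlaw n m xs ys hy, ENNReal.toReal_mul,
    ENNReal.toReal_ofReal (exp_nonneg _)]
  congr 1
  exact ENNReal.toReal_ofReal (wt_nonneg n m xs)

lemma cyl_disj (n m : ℕ) (Y : (Fin (m + 1) → V n) → Fin (m + 1) → ℝ) :
    Pairwise (Function.onFun Disjoint (fun xs => cyl J e n m xs (Y xs))) := by
  intro a b hab
  refine Set.disjoint_left.2 fun ω' h1 h2 => hab ?_
  funext k
  rw [← h1.1 k, h2.1 k]

lemma exp_law (hJ : ∀ n i, Measurable (J n i)) (he : ∀ n i, Measurable (e n i))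
    (hlaw : WalkExpLaw Pw J e) {n : ℕ} (hn : n ≠ 0) (m : ℕ)
    (ys : Fin (m + 1) → ℝ) (hy : ∀ k, 0 ≤ ys k) :
    Pw.real {ω' | ∀ k : Fin (m + 1), ys k < e n k ω'} = exp (-∑ k, ys k) := by
  have h1 : {ω' | ∀ k : Fin (m + 1), ys k < e n k ω'} =
      ⋃ xs ∈ (Finset.univ : Finset (Fin (m + 1) → V n)), cyl J e n m xs ys := by
    ext ω'
    simp only [Set.mem_ofPred_eq, Set.mem_iUnion, cyl]
    exact ⟨fun h => ⟨fun k => J n k ω', Finset.mem_univ _, fun k => rfl, h⟩, fun ⟨xs, _, _, h⟩ => h⟩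
  rw [h1, measureReal_biUnion_finset (fun a _ b _ hab => cyl_disj n m (fun _ => ys) hab)
    (fun xs _ => cyl_meas hJ he n m xs ys)]
  simp_rw [cyl_law hlaw n m _ ys hy]
  rw [← Finset.sum_mul]
  have := sum_wt (n := n) m (fun _ => 1)
  rw [Ek_const hn] at this
  simp only [mul_one] at this
  rw [this, one_mul]

/-- extremal event -/
def Ev (J : (n : ℕ) → ℕ → Ω' → V n) (e : ℕ → ℕ → Ω' → ℝ) (n m : ℕ) (K b : ℝ) (h : V n → ℝ) : Set Ω' :=
  {ω' | ∃ j ∈ Icc 1 m, K < exp (b * h (J n j ω')) * e n j ω'}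

lemma lt_Mx {n : ℕ} (m : ℕ) (xs : Fin (m + 2) → V n) (b : ℝ) (h : V n → ℝ) :
    b < Mx (fun i => extp (m + 1) xs (i + 1)) m h ↔ ∃ j : Fin (m + 2), (j : ℕ) ∈ Icc 1 (m + 1) ∧ b < h (xs j) := by
  unfold Mx
  rw [Finset.lt_sup'_iff]
  constructor
  · rintro ⟨i, hi, h1⟩
    simp at hi
    refine ⟨⟨min (i + 1) (m + 1), by omega⟩, by simp, h1⟩
  · rintro ⟨j, hj, h1⟩
    simp at hj
    refine ⟨j - 1, by simp; omega, ?_⟩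
    have : extp (m + 1) xs (j - 1 + 1) = xs j := by
      unfold extp; congr 1; ext; simp; omega
    simp only [this]; exact h1

lemma Ev_up (hJ : ∀ n i, Measurable (J n i)) (he : ∀ n i, Measurable (e n i))
    (hlaw : WalkExpLaw Pw J e) {n : ℕ} (hn : n ≠ 0) (m : ℕ) (K β b : ℝ)
    (hb : ∀ z x : ℝ, 0 < x → x ≤ n → K < exp (β * z) * x → b < z) (h : V n → ℝ) :
    Pw.real (Ev J e n (m + 1) K β h) ≤
      ∑ xs, wt n (m + 1) xs * (if b < Mx (fun i => extp (m + 1) xs (i + 1)) m h then 1 else 0) +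
        (m + 2) * exp (-n) := by
  classical
  set A : Set Ω' := ⋃ xs ∈ (Finset.univ.filter fun xs : Fin (m + 2) → V n =>
    b < Mx (fun i => extp (m + 1) xs (i + 1)) m h), cyl J e n (m + 1) xs 0 with hA
  set Bk : Fin (m + 2) → Set Ω' := fun k => {ω' | ∀ i : Fin (m + 2),
    (Pi.single k (n : ℝ) : Fin (m + 2) → ℝ) i < e n i ω'} with hBk
  set Z : Set Ω' := {ω' | ∀ k : Fin (m + 2), (0 : Fin (m + 2) → ℝ) k < e n k ω'}ᶜ with hZ
  have hZm : MeasurableSet {ω' | ∀ k : Fin (m + 2), (0 : Fin (m + 2) → ℝ) k < e n k ω'} := by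
    rw [Set.ofPred_forall]
    exact MeasurableSet.iInter fun k => measurableSet_lt measurable_const (he n k)
  have hZ0 : Pw.real Z = 0 := by
    rw [hZ, probReal_compl_eq_one_sub hZm, exp_law hJ he hlaw hn (m + 1) 0 (fun _ => le_rfl)]
    simp
  have hB : ∀ k, Pw.real (Bk k) = exp (-n) := fun k => by
    rw [hBk]
    rw [exp_law hJ he hlaw hn (m + 1) (Pi.single k (n : ℝ)) (fun i => by
      by_cases hik : i = k
      · subst hik; simp
      · simp [hik])]
    simp
  have hsub : Ev J e n (m + 1) K β h ⊆ (A ∪ ⋃ k ∈ (Finset.univ : Finset (Fin (m + 2))), Bk k) ∪ Z := by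
    rintro ω' ⟨j, hj, hj2⟩
    by_cases hz : ω' ∈ Z
    · exact Or.inr hz
    left
    have hpos : ∀ k : Fin (m + 2), 0 < e n k ω' := by simpa [hZ] using hz
    by_cases hbig : ∃ k : Fin (m + 2), (n : ℝ) < e n k ω'
    · right
      obtain ⟨k, hk⟩ := hbig
      simp only [Set.mem_iUnion]
      refine ⟨k, Finset.mem_univ _, fun i => ?_⟩
      by_cases hik : i = k
      · subst hik; simpa using hk
      · simpa [hik] using hpos i
    · left
      push Not at hbig
      simp only [hA, Set.mem_iUnion]
      have hj' : j < m + 2 := by simp at hj; omega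
      refine ⟨fun k => J n k ω', ?_, fun k => rfl, hpos⟩
      simp only [Finset.mem_filter, Finset.mem_univ, true_and]
      rw [lt_Mx]
      exact ⟨⟨j, hj'⟩, hj, hb _ _ (hpos ⟨j, hj'⟩) (hbig ⟨j, hj'⟩) hj2⟩
  refine (measureReal_mono hsub (measure_ne_top _ _)).trans ?_
  refine (measureReal_union_le _ _).trans ?_
  rw [hZ0, add_zero]
  refine (measureReal_union_le _ _).trans (add_le_add ?_ ?_)
  · refine (measureReal_biUnion_finset_le _ _).trans (le_of_eq ?_)
    rw [Finset.sum_filter]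
    refine Finset.sum_congr rfl fun xs _ => ?_
    rw [cyl_law hlaw n (m + 1) xs 0 (fun _ => le_rfl)]
    split_ifs <;> simp
  · refine (measureReal_biUnion_finset_le _ _).trans (le_of_eq ?_)
    simp_rw [hB]
    simp

lemma Ev_low (hJ : ∀ n i, Measurable (J n i)) (he : ∀ n i, Measurable (e n i))
    (hlaw : WalkExpLaw Pw J e) {n : ℕ} (hn : n ≠ 0) (m : ℕ) (K β b : ℝ)
    (hb : ∀ z x : ℝ, 1 / n < x → b < z → K < exp (β * z) * x) (h : V n → ℝ) :
    exp (-(1 / n)) * ∑ xs, wt n (m + 1) xs *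
      (if b < Mx (fun i => extp (m + 1) xs (i + 1)) m h then 1 else 0) ≤
    Pw.real (Ev J e n (m + 1) K β h) := by
  classical
  have hch : ∀ xs : Fin (m + 2) → V n, ∃ j : Fin (m + 2),
      b < Mx (fun i => extp (m + 1) xs (i + 1)) m h → (j : ℕ) ∈ Icc 1 (m + 1) ∧ b < h (xs j) := by
    intro xs
    by_cases hx : b < Mx (fun i => extp (m + 1) xs (i + 1)) m h
    · obtain ⟨j, hj⟩ := (lt_Mx m xs b h).1 hx
      exact ⟨j, fun _ => hj⟩
    · exact ⟨0, fun h' => absurd h' hx⟩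
  choose jj hjj using hch
  set Y : (Fin (m + 2) → V n) → Fin (m + 2) → ℝ := fun xs => Pi.single (jj xs) (1 / (n : ℝ)) with hY
  have hY0 : ∀ xs k, 0 ≤ Y xs k := fun xs k => by
    by_cases hik : k = jj xs
    · subst hik; simp [hY]
    · simp [hY, hik]
  set F := (Finset.univ.filter fun xs : Fin (m + 2) → V n =>
    b < Mx (fun i => extp (m + 1) xs (i + 1)) m h) with hF
  have hsub : (⋃ xs ∈ F, cyl J e n (m + 1) xs (Y xs)) ⊆ Ev J e n (m + 1) K β h := by
    intro ω' hω
    simp only [Set.mem_iUnion] at hω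
    obtain ⟨xs, hxs, h1, h2⟩ := hω
    simp only [hF, Finset.mem_filter, Finset.mem_univ, true_and] at hxs
    obtain ⟨h3, h4⟩ := hjj xs hxs
    refine ⟨jj xs, h3, hb _ _ ?_ ?_⟩
    · simpa [hY] using h2 (jj xs)
    · rw [h1 (jj xs)]; exact h4
  refine le_trans (le_of_eq ?_) (measureReal_mono hsub (measure_ne_top _ _))
  rw [measureReal_biUnion_finset (fun a _ b _ hab => cyl_disj n (m + 1) Y hab)
    (fun xs _ => cyl_meas hJ he n (m + 1) xs _), hF, Finset.sum_filter, Finset.mul_sum]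
  refine Finset.sum_congr rfl fun xs _ => ?_
  rw [cyl_law hlaw n (m + 1) xs _ (hY0 xs)]
  have : ∑ k, Y xs k = 1 / n := by simp [hY]
  rw [this]
  split_ifs <;> simp [mul_comm]

lemma Ev_meas (hJ : ∀ n i, Measurable (J n i)) (he : ∀ n i, Measurable (e n i)) (n m : ℕ) (K β : ℝ) :
    Measurable (fun h : V n → ℝ => Pw.real (Ev J e n m K β h)) := by
  have hE : MeasurableSet {q : (V n → ℝ) × Ω' | ∃ j ∈ Icc 1 m,
      K < exp (β * q.1 (J n j q.2)) * e n j q.2} := by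
    have : {q : (V n → ℝ) × Ω' | ∃ j ∈ Icc 1 m, K < exp (β * q.1 (J n j q.2)) * e n j q.2} =
        ⋃ j ∈ Icc 1 m, {q | K < exp (β * q.1 (J n j q.2)) * e n j q.2} := by ext; simp
    rw [this]
    refine Finset.measurableSet_biUnion _ fun j _ => ?_
    have h1 : Measurable (fun q : (V n → ℝ) × Ω' => q.1 (J n j q.2)) := by
      have : (fun q : (V n → ℝ) × Ω' => q.1 (J n j q.2)) =
          fun q => ∑ x : V n, (J n j ⁻¹' {x}).indicator (fun _ => (1 : ℝ)) q.2 * q.1 x := by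
        funext q
        rw [Finset.sum_eq_single (J n j q.2)]
        · simp
        · intro x _ hx
          rw [Set.indicator_of_notMem (by simpa using hx.symm)]; simp
        · simp
      rw [this]
      refine Finset.measurable_sum _ fun x _ => Measurable.mul ?_ ((measurable_pi_apply x).comp measurable_fst)
      exact (measurable_const.indicator (hJ n j (measurableSet_singleton x))).comp measurable_snd
    exact measurableSet_lt measurable_const ((measurable_exp.comp (h1.const_mul β)).mul
      ((he n j).comp measurable_snd))
  exact (measurable_measure_prodMk_left (ν := Pw) hE).ennreal_toReal

end bridge

section final
variable {Ω' : Type*} [MeasurableSpace Ω'] {Pw : Measure Ω'} [IsProbabilityMeasure Pw]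
    {J : (n : ℕ) → ℕ → Ω' → V n} {e : ℕ → ℕ → Ω' → ℝ}
    {Ω : Type*} [MeasurableSpace Ω] {Pe : Measure Ω} [IsProbabilityMeasure Pe]

lemma chi_int {n : ℕ} (H : V n → Ω → ℝ) (hHm : ∀ x, Measurable (H x)) (m : ℕ) (b : ℝ)
    (x : ℕ → V n) :
    Integrable (fun ω => if b < Mx x m (fun x => H x ω) then (1 : ℝ) else 0) Pe ∧
    ∫ ω, (if b < Mx x m (fun x => H x ω) then (1 : ℝ) else 0) ∂Pe =
      (Pe.map (fun ω x => H x ω)).real {h | b < Mx x m h} := by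
  have hm : Measurable (fun ω x => H x ω) := measurable_pi_lambda _ hHm
  have hS : MeasurableSet {h : V n → ℝ | b < Mx x m h} :=
    measurableSet_lt measurable_const (measurable_Mx x m)
  have e1 : (fun ω => if b < Mx x m (fun x => H x ω) then (1 : ℝ) else 0) =
      ((fun ω x => H x ω) ⁻¹' {h | b < Mx x m h}).indicator 1 := by
    funext ω; simp [Set.indicator]
  rw [e1]
  refine ⟨(integrable_const (1 : ℝ)).indicator (hm hS), ?_⟩
  rw [integral_indicator_one (hm hS), map_measureReal_apply hm hS]

lemma sum_chi {n : ℕ} (H : V n → Ω → ℝ) (hHm : ∀ x, Measurable (H x)) (m : ℕ) (b : ℝ) :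
    Integrable (fun ω => ∑ xs, wt n (m + 1) xs *
      (if b < Mx (fun i => extp (m + 1) xs (i + 1)) m (fun x => H x ω) then (1 : ℝ) else 0)) Pe ∧
    ∫ ω, ∑ xs, wt n (m + 1) xs *
      (if b < Mx (fun i => extp (m + 1) xs (i + 1)) m (fun x => H x ω) then (1 : ℝ) else 0) ∂Pe =
      Qn n (Pe.map (fun ω x => H x ω)) m b := by
  have hi : ∀ xs, Integrable (fun ω => wt n (m + 1) xs *
      (if b < Mx (fun i => extp (m + 1) xs (i + 1)) m (fun x => H x ω) then (1 : ℝ) else 0)) Pe :=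
    fun xs => (chi_int H hHm m b _).1.const_mul _
  refine ⟨integrable_finsetSum _ fun xs _ => hi xs, ?_⟩
  rw [integral_finsetSum _ fun xs _ => hi xs]
  unfold Qn
  rw [← sum_wt]
  refine Finset.sum_congr rfl fun xs _ => ?_
  rw [integral_const_mul, (chi_int H hHm m b _).2]

lemma E_bounds (hJ : ∀ n i, Measurable (J n i)) (he : ∀ n i, Measurable (e n i))
    (hlaw : WalkExpLaw Pw J e) {n : ℕ} (hn : n ≠ 0) (m : ℕ) (K β b₁ b₂ : ℝ)
    (hb₁ : ∀ z x : ℝ, 0 < x → x ≤ n → K < exp (β * z) * x → b₁ < z)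
    (hb₂ : ∀ z x : ℝ, 1 / n < x → b₂ < z → K < exp (β * z) * x)
    (H : V n → Ω → ℝ) (hHm : ∀ x, Measurable (H x)) :
    ∫ ω, Pw.real (Ev J e n (m + 1) K β (fun x => H x ω)) ∂Pe ≤
      Qn n (Pe.map (fun ω x => H x ω)) m b₁ + (m + 2) * exp (-n) ∧
    exp (-(1 / n)) * Qn n (Pe.map (fun ω x => H x ω)) m b₂ ≤
      ∫ ω, Pw.real (Ev J e n (m + 1) K β (fun x => H x ω)) ∂Pe := by
  have hm : Measurable (fun ω x => H x ω) := measurable_pi_lambda _ hHm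
  have h_intg : Integrable (fun ω => Pw.real (Ev J e n (m + 1) K β (fun x => H x ω))) Pe := by
    refine Integrable.of_bound ((Ev_meas hJ he n (m + 1) K β).comp hm).aestronglyMeasurable 1
      (ae_of_all _ fun ω => ?_)
    rw [Real.norm_of_nonneg measureReal_nonneg]
    exact measureReal_le_one
  obtain ⟨i1, q1⟩ := sum_chi (Pe := Pe) H hHm m b₁
  obtain ⟨i2, q2⟩ := sum_chi (Pe := Pe) H hHm m b₂
  constructor
  · refine (integral_mono h_intg (i1.add (integrable_const ((m + 2) * exp (-n)))) fun ω =>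
      Ev_up hJ he hlaw hn m K β b₁ hb₁ _).trans (le_of_eq ?_)
    rw [integral_add' i1 (integrable_const _), q1]
    simp
  · rw [← q2, ← integral_const_mul]
    exact integral_mono (i2.const_mul _) h_intg fun ω => Ev_low hJ he hlaw hn m K β b₂ hb₂ _

lemma err_lim {c : ℝ} (hc0 : 0 < c) :
    Tendsto (fun n : ℕ => aseq c n / (3 * (n : ℝ) ^ 2) *
      ((((θseq n - 1 : ℕ) : ℝ) + 2) * exp (-n))) atTop (nhds 0) := by
  have h1 : Tendsto (fun n : ℕ => 2 * √(2 * π) * ((n : ℝ) ^ (1 / 2 + c) *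
      exp (-(1 / 2 * (n : ℝ) ^ (1 : ℝ))))) atTop (nhds 0) := by
    simpa using (tz (1 / 2 + c) 1 (1 / 2) (by norm_num) (by norm_num)).const_mul (2 * √(2 * π))
  refine squeeze_zero' (Eventually.of_forall fun n => mul_nonneg (div_nonneg (aseq_nonneg c n)
    (by positivity)) (by positivity)) ?_ h1
  filter_upwards [eventually_ne_atTop 0, γ_small hc0] with n hn hγ2
  have hn' : (0 : ℝ) < n := by positivity
  have hn1 : (1 : ℝ) ≤ n := by exact_mod_cast Nat.one_le_iff_ne_zero.2 hn
  have hγ := γ_pos c hn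
  have h2 : ((θseq n - 1 : ℕ) : ℝ) + 2 ≤ 2 * (3 * (n : ℝ) ^ 2) := by
    rw [θcast' hn]; nlinarith
  calc _ ≤ aseq c n / (3 * (n : ℝ) ^ 2) * (2 * (3 * (n : ℝ) ^ 2) * exp (-n)) := by
        have := aseq_nonneg c n
        gcongr
    _ = 2 * (aseq c n * exp (-n)) := by field_simp
    _ ≤ _ := by
        unfold aseq
        rw [γinv, sqrt_mul (by positivity), sqrt_eq_rpow (n : ℝ), mul_assoc (√(2 * π)),
          ← rpow_add hn', mul_assoc, ← exp_add, mul_assoc, rpow_one, mul_assoc]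
        gcongr
        have : γseq c n ^ 2 * n ≤ 1 * n := by gcongr; nlinarith
        linarith

lemma γlog (c : ℝ) (hc0 : 0 < c) : Tendsto (fun n : ℕ => γseq c n * log n) atTop (nhds 0) := by
  have h := ((isLittleO_log_rpow_atTop hc0).tendsto_div_nhds_zero).comp tendsto_natCast_atTop_atTop
  refine h.congr fun n => ?_
  simp only [Function.comp]
  rw [div_eq_inv_mul, ← γinv, inv_inv]

lemma γβlog {c : ℝ} (hc0 : 0 < c) {β : ℕ → ℝ} {β₀ : ℝ} (hβ₀ : 0 < β₀) (hβ : ∀ n, β₀ ≤ β n) :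
    Tendsto (fun n : ℕ => γseq c n * log n / β n) atTop (nhds 0) := by
  have h := (γlog c hc0).div_const β₀
  rw [zero_div] at h
  refine squeeze_zero' ?_ ?_ h
  · filter_upwards [eventually_ne_atTop 0] with n hn
    have hn1 : (1 : ℝ) ≤ n := by exact_mod_cast Nat.one_le_iff_ne_zero.2 hn
    have hγ := γ_pos c hn
    have := log_nonneg hn1
    have := hβ n
    have : 0 < β n := by linarith
    positivity
  · filter_upwards [eventually_ne_atTop 0] with n hn
    have hn1 : (1 : ℝ) ≤ n := by exact_mod_cast Nat.one_le_iff_ne_zero.2 hn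
    have hγ := γ_pos c hn
    have := log_nonneg hn1
    gcongr
    exact hβ n

theorem core (p : ℕ) (hp : 2 ≤ p) (c : ℝ) (hc0 : 0 < c) (hc1 : c < 1 / 2)
    (β : ℕ → ℝ) (β₀ : ℝ) (hβ₀ : 0 < β₀) (hβ : ∀ n : ℕ, β₀ ≤ β n)
    (H : (n : ℕ) → V n → Ω → ℝ) (hHmeas : ∀ n x, Measurable (H n x))
    (hH : ∀ n : ℕ, IsCenteredGaussianVector Pe (H n)
      (fun x y => (n : ℝ) * overlap n x y ^ p))
    (hJmeas : ∀ n i, Measurable (J n i)) (hemeas : ∀ n i, Measurable (e n i))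
    (hlaw : WalkExpLaw Pw J e) (u : ℕ → ℝ) (hu : ∀ n, n ≠ 0 → 0 < u n) (s0 : ℝ)
    (hs : Tendsto (fun n => log (u n)) atTop (nhds s0)) (t : ℝ) (ht : 0 < t) :
    Tendsto (fun n => ∫ ω, nuMax Pw J e c β n t (u n) (fun x => H n x ω) ∂Pe)
        atTop (nhds (2 * p * t * exp (-s0))) := by
  set μ : ∀ n, Measure (V n → ℝ) := fun n => Pe.map (fun ω x => H n x ω) with hμ
  have hG : ∀ n, n ≠ 0 → GV (μ n) (Dl n p) n := fun n hn => GV_of Pe hn (H n) (hHmeas n) (hH n)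
  have hgl := γβlog hc0 hβ₀ hβ
  have hs1 : Tendsto (fun n : ℕ => log (u n) - γseq c n * log n / β n) atTop (nhds s0) := by
    simpa using hs.sub hgl
  have hs2 : Tendsto (fun n : ℕ => log (u n) + γseq c n * log n / β n) atTop (nhds s0) := by
    simpa using hs.add hgl
  have L1 := (Q_lim p hp hc0 hc1 μ hG _ s0 hs1).add (err_lim hc0)
  have he1 : Tendsto (fun n : ℕ => exp (-(1 / (n : ℝ)))) atTop (nhds 1) := by
    have h := (continuous_exp.tendsto _).comp inv_n.neg
    simpa [Function.comp_def] using h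
  have L2 := he1.mul (Q_lim p hp hc0 hc1 μ hG _ s0 hs2)
  rw [add_zero] at L1
  rw [one_mul] at L2
  set K : ℕ → ℝ := fun n => cseq c β n * u n ^ (β n / γseq c n) with hK
  have hmain : Tendsto (fun n => aseq c n / (3 * (n : ℝ) ^ 2) *
      ∫ ω, Pw.real (Ev J e n (θseq n) (K n) (β n) (fun x => H n x ω)) ∂Pe) atTop
      (nhds (2 * (p : ℝ) * exp (-s0))) := by
    have hb : ∀ n, n ≠ 0 → _ := fun n hn => by
      have hn' : (0 : ℝ) < n := by positivity
      have hγ := γ_pos c hn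
      have hβn : 0 < β n := lt_of_lt_of_le hβ₀ (hβ n)
      have hKe : K n = exp (β n * (γseq c n * n + log (u n) / γseq c n)) := by
        simp only [hK, cseq]
        rw [rpow_def_of_pos (hu n hn), ← exp_add]
        congr 1
        field_simp
      exact E_bounds (Pe := Pe) hJmeas hemeas hlaw hn (θseq n - 1) (K n) (β n)
        (γseq c n * n + (log (u n) - γseq c n * log n / β n) / γseq c n)
        (γseq c n * n + (log (u n) + γseq c n * log n / β n) / γseq c n)
        (fun z x hx hxn h => by
          have h1 : K n < exp (β n * z + log n) := by
            rw [exp_add, exp_log hn']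
            exact h.trans_le (mul_le_mul_of_nonneg_left hxn (exp_nonneg _))
          rw [hKe, exp_lt_exp] at h1
          have h2 : γseq c n * n + (log (u n) - γseq c n * log n / β n) / γseq c n =
            (β n * (γseq c n * n + log (u n) / γseq c n) - log n) / β n := by
            field_simp
            ring
          rw [h2, div_lt_iff₀ hβn]; linarith)
        (fun z x hx h => by
          have h2 : γseq c n * n + (log (u n) + γseq c n * log n / β n) / γseq c n =
            (β n * (γseq c n * n + log (u n) / γseq c n) + log n) / β n := by
            field_simp
            ring
          rw [h2, div_lt_iff₀ hβn] at h
          have h1 : K n < exp (β n * z + - log n) := by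
            rw [hKe, exp_lt_exp]; linarith
          rw [exp_add, exp_neg, exp_log hn', ← one_div] at h1
          exact h1.trans (mul_lt_mul_of_pos_left hx (exp_pos _)))
        (H n) (hHmeas n)
    have hθ : ∀ n, n ≠ 0 → θseq n - 1 + 1 = θseq n := fun n hn => by
      have : 0 < n ^ 2 := by positivity
      unfold θseq; omega
    refine tendsto_of_tendsto_of_tendsto_of_le_of_le' L2 L1 ?_ ?_
    · filter_upwards [eventually_ne_atTop 0] with n hn
      have h1 := (hb n hn).2
      rw [hθ n hn] at h1
      have ha : 0 ≤ aseq c n / (3 * (n : ℝ) ^ 2) := div_nonneg (aseq_nonneg c n) (by positivity)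
      have := mul_le_mul_of_nonneg_left h1 ha
      linarith
    · filter_upwards [eventually_ne_atTop 0] with n hn
      have h1 := (hb n hn).1
      rw [hθ n hn] at h1
      have ha : 0 ≤ aseq c n / (3 * (n : ℝ) ^ 2) := div_nonneg (aseq_nonneg c n) (by positivity)
      have := mul_le_mul_of_nonneg_left h1 ha
      linarith
  have hfin := (k_lim hc1 hc0 t ht).mul hmain
  rw [show t * (2 * (p : ℝ) * exp (-s0)) = 2 * p * t * exp (-s0) by ring] at hfin
  refine hfin.congr' ?_
  filter_upwards [eventually_ne_atTop 0] with n hn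
  have hn' : (0 : ℝ) < n := by positivity
  have ha : aseq c n ≠ 0 := by
    have := γ_pos c hn
    unfold aseq; positivity
  unfold nuMax
  rw [integral_const_mul]
  rw [← mul_assoc, div_mul_cancel₀ _ (by positivity)]
  rfl

end final

/-- Convergence of the annealed blocked-maximum intensity (Proposition 3.3):
`𝔼[ν̄_n^t(u,∞)] → 2p·t·u⁻¹`, both for fixed `u` and for `u_n = u·θ_n^{−α_n}`
where `α_n = γ_n/β_n`. -/
theorem expectation_nuMax_tendsto
    (p : ℕ) (hp : 2 ≤ p) (c : ℝ) (hc0 : 0 < c) (hc1 : c < 1 / 2)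
    (β : ℕ → ℝ) (β₀ : ℝ) (hβ₀ : 0 < β₀) (hβ : ∀ n : ℕ, β₀ ≤ β n)
    (B : ℝ) (hB : ∀ n : ℕ, γseq c n * β n ≤ B)
    {Ω : Type*} [MeasurableSpace Ω] (Pe : Measure Ω) [IsProbabilityMeasure Pe]
    (H : (n : ℕ) → V n → Ω → ℝ) (hHmeas : ∀ n x, Measurable (H n x))
    (hH : ∀ n : ℕ, IsCenteredGaussianVector Pe (H n)
      (fun x y => (n : ℝ) * overlap n x y ^ p))
    {Ω' : Type*} [MeasurableSpace Ω'] (Pw : Measure Ω') [IsProbabilityMeasure Pw]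
    (J : (n : ℕ) → ℕ → Ω' → V n) (e : ℕ → ℕ → Ω' → ℝ)
    (hJmeas : ∀ n i, Measurable (J n i)) (hemeas : ∀ n i, Measurable (e n i))
    (hlaw : WalkExpLaw Pw J e) :
    ∀ u : ℝ, 0 < u → ∀ t : ℝ, 0 < t →
      Tendsto (fun n => ∫ ω, nuMax Pw J e c β n t u (fun x => H n x ω) ∂Pe)
        atTop (nhds (2 * p * t / u)) ∧
      Tendsto (fun n => ∫ ω, nuMax Pw J e c β n t
          (u * (θseq n : ℝ) ^ (-(γseq c n / β n))) (fun x => H n x ω) ∂Pe)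
        atTop (nhds (2 * p * t / u)) := by
  intro u hu t ht
  have hlim : 2 * (p : ℝ) * t * exp (-log u) = 2 * p * t / u := by
    rw [exp_neg, exp_log hu, div_eq_mul_inv]
  rw [← hlim]
  refine ⟨core p hp c hc0 hc1 β β₀ hβ₀ hβ H hHmeas hH hJmeas hemeas hlaw (fun _ => u)
    (fun _ _ => hu) (log u) tendsto_const_nhds t ht, ?_⟩
  have hθ : ∀ n : ℕ, n ≠ 0 → (0 : ℝ) < (θseq n : ℝ) := by
    intro n hn
    have : 0 < θseq n := by unfold θseq; positivity
    exact_mod_cast this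
  refine core p hp c hc0 hc1 β β₀ hβ₀ hβ H hHmeas hH hJmeas hemeas hlaw
    (fun n => u * (θseq n : ℝ) ^ (-(γseq c n / β n)))
    (fun n hn => mul_pos hu (rpow_pos_of_pos (hθ n hn) _)) (log u) ?_ t ht
  have h1 := γβlog hc0 hβ₀ hβ
  have h2 : Tendsto (fun n : ℕ => γseq c n / β n) atTop (nhds 0) := by
    have h3 : Tendsto (fun n : ℕ => γseq c n / β₀) atTop (nhds 0) := by
      simpa using (γ_tendsto hc0).div_const β₀
    have hg : ∀ n : ℕ, 0 ≤ γseq c n := fun n => rpow_nonneg (Nat.cast_nonneg n) _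
    refine squeeze_zero (fun n => div_nonneg (hg n) (hβ₀.le.trans (hβ n))) (fun n => ?_) h3
    exact div_le_div_of_nonneg_left (hg n) hβ₀ (hβ n)
  have h4 : Tendsto (fun n : ℕ => log u - (log 3 * (γseq c n / β n)
      + 2 * (γseq c n * log n / β n))) atTop (nhds (log u)) := by
    simpa using tendsto_const_nhds.sub ((h2.const_mul (log 3)).add (h1.const_mul 2))
  refine h4.congr' ?_
  filter_upwards [eventually_ne_atTop 0] with n hn
  have hn0 : (n : ℝ) ≠ 0 := by exact_mod_cast hn
  rw [log_mul hu.ne' (rpow_pos_of_pos (hθ n hn) _).ne', log_rpow (hθ n hn)]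
  have : log (θseq n : ℝ) = log 3 + 2 * log n := by
    unfold θseq
    push_cast
    rw [log_mul (by norm_num) (pow_ne_zero 2 hn0), log_pow]
    norm_num
  rw [this]
  ring
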